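/- arXiv:2311.10307 — 4 statements merged into one kernel-verified Lean document; each statement's English description precedes it below -/
import Mathlib

section
/- Fix rationals α, ξ with 0 < α < ξ ≤ 1/2, and set D := 1 − 4α(1−ξ), μ := (1 − √D)/2, σ² := α(ξ−α)(1−ξ)/D and φ := (σ² − μ)/(1 − 2μ). For each n such that l := αn and m := ξn are integers, let X_n be a random variable with probability mass function p_{n,m,l}. Then the expectation satisfies E[X_n] − nμ → φ as n → ∞ along such n. -/
/-- The Schur–Weyl measurement outcome distribution
`p_{n,m,l}(x) = (C(n,x)/C(n,m))·(C(l,x)/C(m,x))·((n−2x+1)/(n−x+1))·C(n−l−x, m−l)`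
for `0 ≤ x ≤ l` (intended for `0 ≤ l ≤ m` and `2m ≤ n`). -/
noncomputable def pSW (n m l x : ℕ) : ℝ :=
  ((n.choose x : ℝ) / (n.choose m)) * ((l.choose x : ℝ) / (m.choose x)) *
    (((n : ℝ) - 2 * x + 1) / ((n : ℝ) - x + 1)) *
    (((n - l - x).choose (m - l) : ℝ))

/-- For a rational ratio `θ`, the natural number `⌊θ n⌋`; on the set `exactSet`
below this equals `θ n` exactly. -/
def ratIdx (θ : ℚ) (n : ℕ) : ℕ := ⌊θ * n⌋₊

/-- The set of `n` for which both `α n` and `ξ n` are (natural) integers. -/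
def exactSet (α ξ : ℚ) : Set ℕ :=
  {n : ℕ | ((ratIdx α n : ℚ) = α * n) ∧ ((ratIdx ξ n : ℚ) = ξ * n)}

section

open Filter Finset Nat

/-- The weight `pSW (2 * l + d + e) (l + d) l (l - y)` written without truncated subtraction. -/
noncomputable def swWeight (d e l y : ℕ) : ℝ :=
  (l.choose y : ℝ) * (d + e + y)! * (d + y)! * (l + e)! * (d + e + 2 * y + 1) /
    ((d ! : ℝ) * (e + y)! * (l + d + e + y + 1)!)

/-- The Casimir-type quadratic variable `y (y + d + e + 1)`. -/
def swCasimir (d e y : ℕ) : ℝ := y * (y + d + e + 1)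

/-- The expectation against `swWeight`. -/
noncomputable def swMean (d e l : ℕ) (f : ℕ → ℝ) : ℝ :=
  ∑ y ∈ range (l + 1), swWeight d e l y * f y

theorem swWeight_nonneg (d e l y : ℕ) : 0 ≤ swWeight d e l y := by
  unfold swWeight
  positivity

theorem swWeight_eq_zero_of_lt {d e l y : ℕ} (h : l < y) : swWeight d e l y = 0 := by
  simp [swWeight, Nat.choose_eq_zero_of_lt h]

theorem swWeight_zero (d e : ℕ) : swWeight d e 0 0 = 1 := by
  have h1 : ((d + e + 1)! : ℝ) = (d + e + 1) * (d + e)! := by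
    push_cast [Nat.factorial_succ]; ring
  simp only [swWeight, Nat.choose_self, Nat.cast_one, add_zero, zero_add, h1]
  have := Nat.factorial_pos (d + e)
  have := Nat.factorial_pos d
  have := Nat.factorial_pos e
  field_simp
  push_cast
  ring

theorem pSW_eq_swWeight (d e x y : ℕ) :
    pSW (2 * (x + y) + d + e) (x + y + d) (x + y) x = swWeight d e (x + y) y := by
  have hn : (2 * (x + y) + d + e).choose x
      = (x + (x + 2 * y + d + e)).choose x := by congr 1; ring
  have hm : (2 * (x + y) + d + e).choose (x + y + d)
      = ((x + y + d) + (x + y + e)).choose (x + y + d) := by congr 1; ring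
  have hmx : (x + y + d).choose x = (x + (y + d)).choose x := by congr 1; ring
  have hly : (x + y).choose y = (x + y).choose x := Nat.choose_symm_add.symm
  have hz : (2 * (x + y) + d + e - (x + y) - x).choose (x + y + d - (x + y))
      = (d + (e + y)).choose d := by congr 1 <;> omega
  unfold pSW swWeight
  rw [hn, hm, hmx, hly, hz]
  simp only [Nat.cast_add_choose]
  have e1 : x + (x + 2 * y + d + e) = x + y + d + (x + y + e) := by ring
  have e2 : d + (e + y) = d + e + y := by ring
  have e3 : ((x + y + d + e + y + 1)! : ℝ)
      = (x + 2 * y + d + e + 1) * (x + 2 * y + d + e)! := by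
    have : x + y + d + e + y + 1 = (x + 2 * y + d + e) + 1 := by ring
    rw [this, Nat.factorial_succ]; push_cast; ring
  have e4 : x + (y + d) = x + y + d := by ring
  have e5 : y + d = d + y := by ring
  rw [e1, e2, e3, e4, e5]
  have := Nat.factorial_pos (x + y + d + (x + y + e))
  have := Nat.factorial_pos (x + y + d)
  have := Nat.factorial_pos (x + y + e)
  have := Nat.factorial_pos (x + 2 * y + d + e)
  have := Nat.factorial_pos (d + y)
  have := Nat.factorial_pos (e + y)
  have := Nat.factorial_pos d
  have := Nat.factorial_pos x
  have := Nat.factorial_pos y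
  have e6 : ((2 * (x + y) + d + e : ℕ) : ℝ) - 2 * x + 1 = d + e + 2 * y + 1 := by
    push_cast; ring
  have e7 : ((2 * (x + y) + d + e : ℕ) : ℝ) - x + 1 = x + 2 * y + d + e + 1 := by
    push_cast; ring
  rw [e6, e7]
  have : (0 : ℝ) < x + 2 * y + d + e + 1 := by positivity
  field_simp

theorem swWeight_succ_left (d e l y : ℕ) :
    ((l : ℝ) + 1 - y) * (l + y + d + e + 2) * swWeight d e (l + 1) y
      = (l + 1) * (l + 1 + e) * swWeight d e l y := by
  have hc : ((l : ℝ) + 1 - y) * ((l + 1).choose y : ℝ) = (l + 1) * l.choose y := by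
    rcases le_or_gt y (l + 1) with h | h
    · have := Nat.choose_mul_succ_eq l y
      have h' : ((l.choose y * (l + 1) : ℕ) : ℝ) = ((l + 1).choose y * (l + 1 - y) : ℕ) := by
        rw [this]
      push_cast [Nat.cast_sub h] at h'
      linarith
    · simp [Nat.choose_eq_zero_of_lt h, Nat.choose_eq_zero_of_lt (show l < y by omega)]
  have e1 : ((l + 1 + e)! : ℝ) = (l + 1 + e) * (l + e)! := by
    have : l + 1 + e = (l + e) + 1 := by ring
    rw [this, Nat.factorial_succ]; push_cast; ring
  have e2 : ((l + 1 + d + e + y + 1)! : ℝ) = (l + y + d + e + 2) * (l + d + e + y + 1)! := by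
    have : l + 1 + d + e + y + 1 = (l + d + e + y + 1) + 1 := by ring
    rw [this, Nat.factorial_succ]; push_cast; ring
  unfold swWeight
  rw [e1, e2]
  have := Nat.factorial_pos (l + d + e + y + 1)
  have := Nat.factorial_pos (e + y)
  have := Nat.factorial_pos d
  have : (0 : ℝ) < l + y + d + e + 2 := by positivity
  field_simp
  linear_combination hc

theorem swWeight_succ_right (d e l y : ℕ) :
    ((y : ℝ) + 1) * (e + y + 1) * (l + y + d + e + 2) * (d + e + 2 * y + 1)
        * swWeight d e l (y + 1)
      = (l - y) * (d + e + y + 1) * (d + y + 1) * (d + e + 2 * y + 3) * swWeight d e l y := by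
  have hc : ((y : ℝ) + 1) * (l.choose (y + 1) : ℝ) = (l - y) * l.choose y := by
    rcases le_or_gt y l with h | h
    · have := Nat.choose_succ_right_eq l y
      have h' : ((l.choose (y + 1) * (y + 1) : ℕ) : ℝ) = (l.choose y * (l - y) : ℕ) := by
        rw [this]
      push_cast [Nat.cast_sub h] at h'
      linarith
    · simp [Nat.choose_eq_zero_of_lt h, Nat.choose_eq_zero_of_lt (show l < y + 1 by omega)]
  have e1 : ((d + e + (y + 1))! : ℝ) = (d + e + y + 1) * (d + e + y)! := by
    rw [← add_assoc, Nat.factorial_succ]; push_cast; ring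
  have e2 : ((d + (y + 1))! : ℝ) = (d + y + 1) * (d + y)! := by
    rw [← add_assoc, Nat.factorial_succ]; push_cast; ring
  have e3 : ((e + (y + 1))! : ℝ) = (e + y + 1) * (e + y)! := by
    rw [← add_assoc, Nat.factorial_succ]; push_cast; ring
  have e4 : ((l + d + e + (y + 1) + 1)! : ℝ) = (l + y + d + e + 2) * (l + d + e + y + 1)! := by
    have : l + d + e + (y + 1) + 1 = (l + d + e + y + 1) + 1 := by ring
    rw [this, Nat.factorial_succ]; push_cast; ring
  unfold swWeight
  rw [e1, e2, e3, e4]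
  have := Nat.factorial_pos (l + d + e + y + 1)
  have := Nat.factorial_pos (e + y)
  have := Nat.factorial_pos d
  have : (0 : ℝ) < l + y + d + e + 2 := by positivity
  push_cast
  field_simp
  linear_combination ((d : ℝ) + e + 2 * y + 3) * hc

theorem swWeight_succ_succ (d e l y : ℕ) :
    ((y : ℝ) + 1) * (e + y + 1) * (l + y + d + e + 2) * (l + y + d + e + 3)
        * (d + e + 2 * y + 1) * swWeight d e (l + 1) (y + 1)
      = (l + 1) * (l + 1 + e) * (d + e + y + 1) * (d + y + 1) * (d + e + 2 * y + 3)
        * swWeight d e l y := by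
  have hc : ((y : ℝ) + 1) * ((l + 1).choose (y + 1) : ℝ) = (l + 1) * l.choose y := by
    have := Nat.add_one_mul_choose_eq l y
    have h' : (((l + 1) * l.choose y : ℕ) : ℝ) = ((l + 1).choose (y + 1) * (y + 1) : ℕ) := by
      rw [this]
    push_cast at h'
    linarith
  have e1 : ((d + e + (y + 1))! : ℝ) = (d + e + y + 1) * (d + e + y)! := by
    rw [← add_assoc, Nat.factorial_succ]; push_cast; ring
  have e2 : ((d + (y + 1))! : ℝ) = (d + y + 1) * (d + y)! := by
    rw [← add_assoc, Nat.factorial_succ]; push_cast; ring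
  have e3 : ((e + (y + 1))! : ℝ) = (e + y + 1) * (e + y)! := by
    rw [← add_assoc, Nat.factorial_succ]; push_cast; ring
  have e4 : ((l + 1 + d + e + (y + 1) + 1)! : ℝ)
      = (l + y + d + e + 3) * (l + y + d + e + 2) * (l + d + e + y + 1)! := by
    have : l + 1 + d + e + (y + 1) + 1 = (l + d + e + y + 1) + 1 + 1 := by ring
    rw [this, Nat.factorial_succ, Nat.factorial_succ]; push_cast; ring
  have e5 : ((l + 1 + e)! : ℝ) = (l + 1 + e) * (l + e)! := by
    have : l + 1 + e = (l + e) + 1 := by ring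
    rw [this, Nat.factorial_succ]; push_cast; ring
  unfold swWeight
  rw [e1, e2, e3, e4, e5]
  have := Nat.factorial_pos (l + d + e + y + 1)
  have := Nat.factorial_pos (e + y)
  have := Nat.factorial_pos d
  have : (0 : ℝ) < l + y + d + e + 2 := by positivity
  have : (0 : ℝ) < l + y + d + e + 3 := by positivity
  push_cast
  field_simp
  linear_combination ((d : ℝ) + e + 2 * y + 3) * hc

theorem sum_swWeight_succ_sub (d e l N : ℕ) :
    ∑ y ∈ range (N + 1), (swWeight d e (l + 1) y - swWeight d e l y)
      = -((d + N + 1) * (d + e + N + 1) / ((l + N + d + e + 2) * (d + e + 2 * N + 1)))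
        * swWeight d e l N := by
  induction N with
  | zero =>
    have h := swWeight_succ_left d e l 0
    simp only [zero_add, sum_range_one, Nat.cast_zero, add_zero, mul_zero, sub_zero] at h ⊢
    have h1 : (0 : ℝ) < l + d + e + 2 := by positivity
    have h2 : (0 : ℝ) < l + 1 := by positivity
    have h3 : (0 : ℝ) < d + e + 1 := by positivity
    have h4 : swWeight d e (l + 1) 0 = (l + 1 + e) * swWeight d e l 0 / (l + d + e + 2) := by
      rw [eq_div_iff h1.ne']
      apply mul_left_cancel₀ h2.ne'
      linear_combination h
    rw [h4]
    field_simp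
    ring
  | succ N ih =>
    rw [sum_range_succ, ih]
    have hr := swWeight_succ_right d e l N
    have hs := swWeight_succ_succ d e l N
    push_cast
    have h1 : (0 : ℝ) < l + N + d + e + 2 := by positivity
    have h1' : (0 : ℝ) < l + (N + 1) + d + e + 2 := by positivity
    have h1'' : (0 : ℝ) < l + N + d + e + 3 := by positivity
    have h2 : (0 : ℝ) < N + 1 := by positivity
    have h3 : (0 : ℝ) < e + N + 1 := by positivity
    have h4 : (0 : ℝ) < d + e + 2 * N + 1 := by positivity
    have h4' : (0 : ℝ) < d + e + 2 * (N + 1) + 1 := by positivity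
    have hr' : swWeight d e l (N + 1) = (l - N) * (d + e + N + 1) * (d + N + 1)
        * (d + e + 2 * N + 3) * swWeight d e l N
        / ((N + 1) * (e + N + 1) * (l + N + d + e + 2) * (d + e + 2 * N + 1)) := by
      rw [eq_div_iff (by positivity), ← hr]; ring
    have hs' : swWeight d e (l + 1) (N + 1) = (l + 1) * (l + 1 + e) * (d + e + N + 1)
        * (d + N + 1) * (d + e + 2 * N + 3) * swWeight d e l N
        / ((N + 1) * (e + N + 1) * (l + N + d + e + 2) * (l + N + d + e + 3)
          * (d + e + 2 * N + 1)) := by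
      rw [eq_div_iff (by positivity), ← hs]; ring
    have a1 : (l : ℝ) + (N + 1) + d + e + 2 = l + N + d + e + 3 := by ring
    have a2 : (d : ℝ) + e + 2 * (N + 1) + 1 = d + e + 2 * N + 3 := by ring
    rw [a2] at h4'
    rw [hr', hs', a1, a2]
    field_simp
    ring

theorem swMean_one (d e l : ℕ) : swMean d e l (fun _ => 1) = 1 := by
  simp only [swMean, mul_one]
  induction l with
  | zero => simp [swWeight_zero]
  | succ l ih =>
    have h := sum_swWeight_succ_sub d e l (l + 1)
    rw [swWeight_eq_zero_of_lt (Nat.lt_succ_self l), mul_zero, sum_sub_distrib,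
      sum_range_succ (swWeight d e l), swWeight_eq_zero_of_lt (Nat.lt_succ_self l), ih] at h
    linarith

theorem swMean_succ_casimir_mul (d e l : ℕ) (f : ℕ → ℝ) :
    swMean d e (l + 1) (fun y => swCasimir d e y * f y)
      = (l + 1) * (l + d + e + 2) * swMean d e (l + 1) f
        - (l + 1) * (l + 1 + e) * swMean d e l f := by
  have h : swMean d e l f = ∑ y ∈ range (l + 1 + 1), swWeight d e l y * f y := by
    rw [sum_range_succ, swWeight_eq_zero_of_lt (Nat.lt_succ_self l)]
    simp [swMean]
  rw [h]
  simp only [swMean, mul_sum, ← sum_sub_distrib]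
  refine sum_congr rfl fun y _ => ?_
  have h := swWeight_succ_left d e l y
  simp only [swCasimir]
  linear_combination -f y * h

theorem swMean_zero (d e : ℕ) (f : ℕ → ℝ) : swMean d e 0 f = f 0 := by
  simp [swMean, swWeight_zero]

theorem swMean_casimir (d e l : ℕ) : swMean d e l (swCasimir d e) = l * (d + 1) := by
  cases l with
  | zero => simp [swMean_zero, swCasimir]
  | succ l =>
    have h := swMean_succ_casimir_mul d e l (fun _ => 1)
    simp only [mul_one, swMean_one] at h
    rw [h]; push_cast; ring

theorem swMean_casimir_sq (d e l : ℕ) :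
    swMean d e l (fun y => swCasimir d e y ^ 2)
      = (l * (d + 1)) ^ 2 + l * (l + e) * (d + 1) := by
  cases l with
  | zero => simp [swMean_zero, swCasimir]
  | succ l =>
    have h := swMean_succ_casimir_mul d e l (swCasimir d e)
    simp only [swMean_casimir] at h
    simp only [sq (swCasimir d e _)]
    rw [h]; push_cast; ring

theorem swMean_casimir_cube (d e l : ℕ) :
    swMean d e l (fun y => swCasimir d e y ^ 3)
      = (l * (d + 1)) ^ 3 + 3 * (l * (l + e) * (d + 1)) * (l * (d + 1))
        + l * (l + e) * (d + 1) * (2 * l + e - d - 2) := by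
  cases l with
  | zero => simp [swMean_zero, swCasimir]
  | succ l =>
    have h := swMean_succ_casimir_mul d e l (fun y => swCasimir d e y ^ 2)
    simp only [swMean_casimir_sq] at h
    simp only [pow_succ' (swCasimir d e _) 2]
    rw [h]; push_cast; ring

/-- The fourth central moment of `swCasimir`, up to the factor `l (l + e) (d + 1)`. -/
def swKurt (d e l : ℝ) : ℝ :=
  (2 * l - 1 + e) * (2 * l + e - d - 2) + (2 + 3 * (d + 1)) * ((l - 1) * (l - 1 + e)) + (d + 1) ^ 2

theorem swMean_casimir_fourth (d e l : ℕ) :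
    swMean d e l (fun y => swCasimir d e y ^ 4)
      = (l * (d + 1)) ^ 4 + 6 * (l * (l + e) * (d + 1)) * (l * (d + 1)) ^ 2
        + 4 * (l * (l + e) * (d + 1) * (2 * l + e - d - 2)) * (l * (d + 1))
        + l * (l + e) * (d + 1) * swKurt d e l := by
  cases l with
  | zero => simp [swMean_zero, swCasimir]
  | succ l =>
    have h := swMean_succ_casimir_mul d e l (fun y => swCasimir d e y ^ 3)
    simp only [swMean_casimir_cube] at h
    simp only [pow_succ' (swCasimir d e _) 3, swKurt]
    rw [h]; push_cast; ring

theorem swMean_central_sq (d e l : ℕ) :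
    swMean d e l (fun y => (swCasimir d e y - l * (d + 1)) ^ 2) = l * (l + e) * (d + 1) := by
  set a : ℝ := l * (d + 1) with ha
  have h : swMean d e l (fun y => (swCasimir d e y - a) ^ 2)
      = swMean d e l (fun y => swCasimir d e y ^ 2) - 2 * a * swMean d e l (swCasimir d e)
        + a ^ 2 * swMean d e l (fun _ => 1) := by
    simp only [swMean, mul_sum, ← sum_sub_distrib, ← sum_add_distrib]
    exact sum_congr rfl fun y _ => by ring
  rw [h, swMean_casimir_sq, swMean_casimir, swMean_one, ← ha]
  ring

theorem swMean_central_fourth (d e l : ℕ) :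
    swMean d e l (fun y => (swCasimir d e y - l * (d + 1)) ^ 4)
      = l * (l + e) * (d + 1) * swKurt d e l := by
  set a : ℝ := l * (d + 1) with ha
  have h : swMean d e l (fun y => (swCasimir d e y - a) ^ 4)
      = swMean d e l (fun y => swCasimir d e y ^ 4)
        - 4 * a * swMean d e l (fun y => swCasimir d e y ^ 3)
        + 6 * a ^ 2 * swMean d e l (fun y => swCasimir d e y ^ 2)
        - 4 * a ^ 3 * swMean d e l (swCasimir d e)
        + a ^ 4 * swMean d e l (fun _ => 1) := by
    simp only [swMean, mul_sum, ← sum_sub_distrib, ← sum_add_distrib]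
    exact sum_congr rfl fun y _ => by ring
  rw [h, swMean_casimir_fourth, swMean_casimir_cube, swMean_casimir_sq, swMean_casimir,
    swMean_one, ← ha]
  ring

theorem swKurt_le {d e l t : ℝ} (hd : 0 ≤ d) (he : 0 ≤ e) (hl : 1 ≤ l)
    (hdt : d ≤ t) (het : e ≤ t) (hlt : l ≤ t) :
    l * (l + e) * (d + 1) * swKurt d e l ≤ 140 * t ^ 6 := by
  have ht : 1 ≤ t := hl.trans hlt
  have b1 : (2 * l - 1 + e) * (2 * l + e - d - 2) ≤ 3 * t * (3 * t) :=
    mul_le_mul_of_nonneg (by linarith) (by linarith) (by linarith) (by linarith)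
  have b2 : (l - 1) * (l - 1 + e) ≤ t * (2 * t) :=
    mul_le_mul (by linarith) (by linarith) (by linarith) (by linarith)
  have b3 : (2 + 3 * (d + 1)) * ((l - 1) * (l - 1 + e)) ≤ 8 * t * (t * (2 * t)) :=
    mul_le_mul (by linarith) b2 (mul_nonneg (by linarith) (by linarith)) (by linarith)
  have b4 : (d + 1) ^ 2 ≤ (2 * t) ^ 2 := pow_le_pow_left₀ (by linarith) (by linarith) 2
  have b5 : t ^ 2 ≤ t ^ 3 := pow_le_pow_right₀ ht (by norm_num)
  have b6 : swKurt d e l ≤ 35 * t ^ 3 := by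
    unfold swKurt
    nlinarith
  have b7 : l * (l + e) ≤ t * (2 * t) :=
    mul_le_mul hlt (by linarith) (by linarith) (by linarith)
  have b8 : l * (l + e) * (d + 1) ≤ t * (2 * t) * (2 * t) :=
    mul_le_mul b7 (by linarith) (by linarith) (by positivity)
  calc l * (l + e) * (d + 1) * swKurt d e l ≤ l * (l + e) * (d + 1) * (35 * t ^ 3) :=
        mul_le_mul_of_nonneg_left b6 (by positivity)
    _ ≤ t * (2 * t) * (2 * t) * (35 * t ^ 3) := mul_le_mul_of_nonneg_right b8 (by positivity)
    _ = 140 * t ^ 6 := by ring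

/-- Second order expansion of the square root of `T ^ 2` around `s ^ 2`. -/
theorem abs_sub_sqrt_expansion_le {T s r : ℝ} (hT : 0 ≤ T) (hs : 0 < s) (hr : 0 < r) :
    |T - (s + (T ^ 2 - s ^ 2) / (2 * s) - (T ^ 2 - s ^ 2) ^ 2 / (8 * s ^ 3))|
      ≤ (r * ((T ^ 2 - s ^ 2) ^ 2 / s ^ 4) + (T ^ 2 - s ^ 2) ^ 4 / (r * s ^ 6)) / 4
        + (T ^ 2 - s ^ 2) ^ 4 / (8 * s ^ 7) := by
  have hexp : T - (s + (T ^ 2 - s ^ 2) / (2 * s) - (T ^ 2 - s ^ 2) ^ 2 / (8 * s ^ 3))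
      = (T - s) ^ 3 / (2 * s ^ 2) + (T - s) ^ 4 / (8 * s ^ 3) := by
    field_simp
    ring
  have hv : (T - s) ^ 2 ≤ (T ^ 2 - s ^ 2) ^ 2 / s ^ 2 := by
    rw [le_div_iff₀ (by positivity)]
    have : (T ^ 2 - s ^ 2) ^ 2 = (T - s) ^ 2 * (T + s) ^ 2 := by ring
    rw [this]
    exact mul_le_mul_of_nonneg_left (pow_le_pow_left₀ hs.le (by linarith) 2) (sq_nonneg _)
  have hv4 : (T - s) ^ 4 ≤ (T ^ 2 - s ^ 2) ^ 4 / s ^ 4 := by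
    have := pow_le_pow_left₀ (sq_nonneg (T - s)) hv 2
    calc (T - s) ^ 4 = ((T - s) ^ 2) ^ 2 := by ring
      _ ≤ _ := this
      _ = _ := by rw [div_pow, ← pow_mul, ← pow_mul]
  have hv3 : |(T - s) ^ 3| ≤ (r * (T - s) ^ 2 + (T - s) ^ 4 / r) / 2 := by
    have h1 : |(T - s) ^ 3| = |T - s| * (T - s) ^ 2 := by
      rw [abs_pow, ← sq_abs (T - s)]; ring
    have h2 : (T - s) ^ 4 = |T - s| ^ 2 * (T - s) ^ 2 := by rw [sq_abs]; ring
    have h3 : |T - s| ≤ (r + |T - s| ^ 2 / r) / 2 := by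
      rw [le_div_iff₀ (by norm_num), ← sub_nonneg]
      have : r + |T - s| ^ 2 / r - |T - s| * 2 = (r - |T - s|) ^ 2 / r := by
        field_simp
        ring
      rw [this]; positivity
    rw [h1, h2]
    calc |T - s| * (T - s) ^ 2 ≤ (r + |T - s| ^ 2 / r) / 2 * (T - s) ^ 2 :=
          mul_le_mul_of_nonneg_right h3 (sq_nonneg _)
      _ = _ := by ring
  rw [hexp]
  calc |(T - s) ^ 3 / (2 * s ^ 2) + (T - s) ^ 4 / (8 * s ^ 3)|
      ≤ |(T - s) ^ 3 / (2 * s ^ 2)| + |(T - s) ^ 4 / (8 * s ^ 3)| := abs_add_le _ _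
    _ = |(T - s) ^ 3| / (2 * s ^ 2) + (T - s) ^ 4 / (8 * s ^ 3) := by
        rw [abs_div, abs_of_pos (show 0 < 2 * s ^ 2 by positivity),
          abs_of_nonneg (show 0 ≤ (T - s) ^ 4 / (8 * s ^ 3) by positivity)]
    _ ≤ (r * ((T ^ 2 - s ^ 2) ^ 2 / s ^ 2) + (T ^ 2 - s ^ 2) ^ 4 / s ^ 4 / r) / 2 / (2 * s ^ 2)
        + (T ^ 2 - s ^ 2) ^ 4 / s ^ 4 / (8 * s ^ 3) := by
        gcongr
        exact hv3.trans (by gcongr)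
    _ = _ := by
        field_simp
        ring

theorem abs_swMean_sub_le (d e l : ℕ) {s r : ℝ} (hs : 0 < s) (hr : 0 < r)
    (hs2 : s ^ 2 = (d + e + 1 : ℝ) ^ 2 + 4 * (l * (d + 1))) :
    |swMean d e l (fun y => (d + e + 1 + 2 * y : ℝ))
        - (s - 16 * (l * (l + e) * (d + 1)) / (8 * s ^ 3))|
      ≤ (r * (16 * (l * (l + e) * (d + 1)) / s ^ 4)
          + 256 * (l * (l + e) * (d + 1) * swKurt d e l) / (r * s ^ 6)) / 4
        + 256 * (l * (l + e) * (d + 1) * swKurt d e l) / (8 * s ^ 7) := by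
  have hu (y : ℕ) : (d + e + 1 + 2 * y : ℝ) ^ 2 - s ^ 2
      = 4 * (swCasimir d e y - l * (d + 1)) := by
    rw [hs2, swCasimir]; ring
  have h0 := swMean_one d e l
  have h1 := swMean_casimir d e l
  have h2 := swMean_central_sq d e l
  have h4 := swMean_central_fourth d e l
  have key (y : ℕ) := abs_sub_sqrt_expansion_le
    (show (0 : ℝ) ≤ d + e + 1 + 2 * y by positivity) hs hr
  simp only [hu] at key
  have hlhs : swMean d e l (fun y => (d + e + 1 + 2 * y : ℝ))
        - (s - 16 * (l * (l + e) * (d + 1)) / (8 * s ^ 3))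
      = ∑ y ∈ range (l + 1), swWeight d e l y * ((d + e + 1 + 2 * y : ℝ)
        - (s + 4 * (swCasimir d e y - l * (d + 1)) / (2 * s)
          - (4 * (swCasimir d e y - l * (d + 1))) ^ 2 / (8 * s ^ 3))) := by
    have : s - 16 * (l * (l + e) * (d + 1)) / (8 * s ^ 3)
        = s * swMean d e l (fun _ => 1)
          + 4 / (2 * s) * (swMean d e l (swCasimir d e)
            - l * (d + 1) * swMean d e l (fun _ => 1))
          - 16 / (8 * s ^ 3)
            * swMean d e l (fun y => (swCasimir d e y - l * (d + 1)) ^ 2) := by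
      rw [h0, h1, h2]; ring
    rw [this]
    simp only [swMean, mul_sum, ← sum_sub_distrib, ← sum_add_distrib]
    exact sum_congr rfl fun y _ => by ring
  have hrhs : (r * (16 * (l * (l + e) * (d + 1)) / s ^ 4)
          + 256 * (l * (l + e) * (d + 1) * swKurt d e l) / (r * s ^ 6)) / 4
        + 256 * (l * (l + e) * (d + 1) * swKurt d e l) / (8 * s ^ 7)
      = ∑ y ∈ range (l + 1), swWeight d e l y *
        ((r * ((4 * (swCasimir d e y - l * (d + 1))) ^ 2 / s ^ 4)
          + (4 * (swCasimir d e y - l * (d + 1))) ^ 4 / (r * s ^ 6)) / 4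
        + (4 * (swCasimir d e y - l * (d + 1))) ^ 4 / (8 * s ^ 7)) := by
    rw [← h4, ← h2]
    simp only [swMean, mul_sum, sum_div, ← sum_add_distrib]
    exact sum_congr rfl fun y _ => by ring
  rw [hlhs, hrhs]
  refine (abs_sum_le_sum_abs _ _).trans (sum_le_sum fun y _ => ?_)
  rw [abs_mul, abs_of_nonneg (swWeight_nonneg d e l y)]
  exact mul_le_mul_of_nonneg_left (key y) (swWeight_nonneg d e l y)

theorem sum_mul_pSW (d e l : ℕ) :
    ∑ x ∈ range (l + 1), (x : ℝ) * pSW (2 * l + d + e) (l + d) l x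
      = ((2 * l + d + e : ℝ) + 1 - swMean d e l (fun y => (d + e + 1 + 2 * y : ℝ))) / 2 := by
  have h0 := swMean_one d e l
  have : ((2 * l + d + e : ℝ) + 1 - swMean d e l (fun y => (d + e + 1 + 2 * y : ℝ))) / 2
      = ((2 * l + d + e + 1 : ℝ) * swMean d e l (fun _ => 1)
          - swMean d e l (fun y => (d + e + 1 + 2 * y : ℝ))) / 2 := by rw [h0]; ring
  rw [this, ← sum_range_reflect]
  simp only [swMean, mul_sum, sum_div, ← sum_sub_distrib]
  refine sum_congr rfl fun y hy => ?_
  obtain ⟨x, rfl⟩ : ∃ x, l = x + y := ⟨l - y, by grind⟩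
  have : x + y + 1 - 1 - y = x := by omega
  rw [this, pSW_eq_swWeight]
  push_cast
  ring

theorem tendsto_sqrt_quadratic_div {D : ℝ} :
    Tendsto (fun t : ℝ => √(D * t ^ 2 + 2 * t + 1) / t) atTop (nhds (√D)) := by
  have h : Tendsto (fun t : ℝ => √(D + 2 * t⁻¹ + t⁻¹ ^ 2)) atTop (nhds (√(D + 2 * 0 + 0 ^ 2))) :=
    (((tendsto_inv_atTop_zero.const_mul 2).const_add D).add
      (tendsto_inv_atTop_zero.pow 2)).sqrt
  have h0 : D + 2 * 0 + 0 ^ 2 = D := by ring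
  rw [h0] at h
  refine h.congr' ?_
  filter_upwards [eventually_gt_atTop 0] with t ht
  have : D + 2 * t⁻¹ + t⁻¹ ^ 2 = (D * t ^ 2 + 2 * t + 1) / t ^ 2 := by
    field_simp
  rw [this, Real.sqrt_div' _ (by positivity), Real.sqrt_sq ht.le]

theorem tendsto_sqrt_quadratic_sub {D : ℝ} (hD : 0 < D) :
    Tendsto (fun t : ℝ => √(D * t ^ 2 + 2 * t + 1) - t * √D) atTop (nhds (1 / √D)) := by
  have hD' := Real.sqrt_pos.2 hD
  have h : Tendsto (fun t : ℝ => (2 + t⁻¹) / (√(D * t ^ 2 + 2 * t + 1) / t + √D)) atTop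
      (nhds ((2 + 0) / (√D + √D))) :=
    (tendsto_inv_atTop_zero.const_add 2).div (tendsto_sqrt_quadratic_div.add_const _)
      (by positivity)
  have h0 : (2 + 0) / (√D + √D) = 1 / √D := by
    field_simp
    norm_num
  rw [h0] at h
  refine h.congr' ?_
  filter_upwards [eventually_gt_atTop 0] with t ht
  have hs : 0 ≤ √(D * t ^ 2 + 2 * t + 1) := Real.sqrt_nonneg _
  have hsq := Real.sq_sqrt (show 0 ≤ D * t ^ 2 + 2 * t + 1 by positivity)
  have hDq := Real.sq_sqrt hD.le
  set s := √(D * t ^ 2 + 2 * t + 1)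
  have : 0 < s + t * √D := by positivity
  field_simp
  linear_combination t ^ 2 * hDq - hsq

end

open Filter in
/-- precise asymptotics of the expectation: `E[X_n] − nμ → φ`
where `φ = (σ² − μ)/(1 − 2μ)`, along those `n` for which `αn` and `ξn` are
integers. -/
theorem statement_13 (α ξ : ℚ) (h0 : 0 < α) (h1 : α < ξ) (h2 : ξ ≤ 1 / 2)
    (D μ σ2 φ : ℝ) (hD : D = 1 - 4 * (α : ℝ) * (1 - (ξ : ℝ)))
    (hμ : μ = (1 - Real.sqrt D) / 2)
    (hσ2 : σ2 = (α : ℝ) * ((ξ : ℝ) - (α : ℝ)) * (1 - (ξ : ℝ)) / D)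
    (hφ : φ = (σ2 - μ) / (1 - 2 * μ)) :
    Tendsto (fun n : ℕ =>
        (∑ x ∈ Finset.range (ratIdx α n + 1),
            (x : ℝ) * pSW n (ratIdx ξ n) (ratIdx α n) x) - n * μ)
      (atTop ⊓ Filter.principal (exactSet α ξ)) (nhds φ) := by
  have ha : (0 : ℝ) < α := by exact_mod_cast h0
  have hab : (α : ℝ) < ξ := by exact_mod_cast h1
  have hb : (ξ : ℝ) ≤ 1 / 2 := by
    have : ((ξ : ℚ) : ℝ) ≤ ((1 / 2 : ℚ) : ℝ) := by exact_mod_cast h2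
    simpa using this
  have hcα : ∀ n ∈ exactSet α ξ, (ratIdx α n : ℝ) = α * n := fun n hn => by exact_mod_cast hn.1
  have hcξ : ∀ n ∈ exactSet α ξ, (ratIdx ξ n : ℝ) = ξ * n := fun n hn => by exact_mod_cast hn.2
  generalize (α : ℝ) = a at *
  generalize (ξ : ℝ) = b at *
  have hDpos : 0 < D := by rw [hD]; nlinarith [sq_nonneg (1 - 2 * b)]
  have hD' : 0 < √D := Real.sqrt_pos.2 hDpos
  have hDq : √D ^ 2 = D := Real.sq_sqrt hDpos.le
  set v : ℝ → ℝ := fun t => a * t * (a * t + (1 - b - a) * t) * ((b - a) * t + 1) with hv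
  set s : ℝ → ℝ := fun t => √(D * t ^ 2 + 2 * t + 1) with hs
  have hspos (t : ℝ) (ht : 0 < t) : 0 < s t := Real.sqrt_pos.2 (by positivity)
  have lims : Tendsto (fun t => s t / t) atTop (nhds (√D)) := tendsto_sqrt_quadratic_div
  have lims' : Tendsto (fun t => s t - t * √D) atTop (nhds (1 / √D)) :=
    tendsto_sqrt_quadratic_sub hDpos
  have limv : Tendsto (fun t => v t / t ^ 3) atTop (nhds (a * (1 - b) * ((b - a) + 0))) := by
    refine ((tendsto_inv_atTop_zero.const_add (b - a)).const_mul (a * (1 - b))).congr' ?_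
    filter_upwards [eventually_gt_atTop 0] with t ht
    simp only [hv]
    field_simp
    ring
  have limw : Tendsto (fun t : ℝ => (√t)⁻¹) atTop (nhds 0) :=
    tendsto_inv_atTop_zero.comp Real.tendsto_sqrt_atTop
  have lim_main : Tendsto (fun t : ℝ => (t + 1 - (s t - 16 * v t / (8 * s t ^ 3))) / 2 - t * μ)
      atTop (nhds φ) := by
    have h := ((lims'.const_sub 1).add
      ((limv.const_mul 2).div (lims.pow 3) (by positivity))).div_const 2
    have hlim : (1 - 1 / √D + 2 * (a * (1 - b) * ((b - a) + 0)) / √D ^ 3) / 2 = φ := by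
      have h12 : 1 - 2 * μ = √D := by rw [hμ]; ring
      rw [hφ, h12, hσ2, hμ, show a * (b - a) * (1 - b) / D = a * (b - a) * (1 - b) / √D ^ 2 by
        rw [hDq]]
      field_simp
      ring
    rw [hlim] at h
    refine h.congr' ?_
    filter_upwards [eventually_gt_atTop 0] with t ht
    have := hspos t ht
    simp only [Pi.div_apply]
    rw [hμ]
    field_simp
    ring
  have lim_err : Tendsto (fun t : ℝ => ((√t * (16 * v t / s t ^ 4)
        + 256 * (140 * t ^ 6) / (√t * s t ^ 6)) / 4
        + 256 * (140 * t ^ 6) / (8 * s t ^ 7)) / 2) atTop (nhds 0) := by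
    have hA := (limw.mul (limv.const_mul 16)).div (lims.pow 4) (by positivity)
    have hB := (limw.const_mul (256 * 140)).div (lims.pow 6) (by positivity)
    have hC := ((tendsto_inv_atTop_zero (𝕜 := ℝ)).const_mul (32 * 140)).div (lims.pow 7)
      (by positivity)
    have h := (((hA.add hB).div_const 4).add hC).div_const 2
    simp only [zero_mul, mul_zero, zero_div, add_zero] at h
    refine h.congr' ?_
    filter_upwards [eventually_gt_atTop 0] with t ht
    have hst := hspos t ht
    have hr : 0 < √t := Real.sqrt_pos.2 ht
    have hrq : √t ^ 2 = t := Real.sq_sqrt ht.le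
    simp only [Pi.div_apply]
    have e1 : (√t)⁻¹ * (16 * (v t / t ^ 3)) / (s t / t) ^ 4 = √t * (16 * v t / s t ^ 4) := by
      field_simp
      rw [hrq, mul_comm]
    have e2 : 256 * 140 * (√t)⁻¹ / (s t / t) ^ 6 = 256 * (140 * t ^ 6) / (√t * s t ^ 6) := by
      field_simp
    have e3 : 32 * 140 * t⁻¹ / (s t / t) ^ 7 = 256 * (140 * t ^ 6) / (8 * s t ^ 7) := by
      field_simp
      norm_num
    rw [e1, e2, e3]
  have hcast : Tendsto (fun n : ℕ => (n : ℝ)) (atTop ⊓ 𝓟 (exactSet α ξ)) atTop :=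
    tendsto_natCast_atTop_atTop.mono_left inf_le_left
  have hM := lim_main.comp hcast
  have hE := lim_err.comp hcast
  refine tendsto_of_tendsto_of_dist hM (squeeze_zero' (Eventually.of_forall fun _ => dist_nonneg)
    ?_ hE)
  have hmem : ∀ᶠ n in atTop ⊓ 𝓟 (exactSet α ξ), n ∈ exactSet α ξ :=
    mem_inf_of_right (mem_principal_self _)
  have hge : ∀ᶠ n : ℕ in atTop ⊓ 𝓟 (exactSet α ξ), 1 ≤ n :=
    (eventually_ge_atTop 1).filter_mono inf_le_left
  filter_upwards [hmem, hge] with n hn hn1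
  have hl := hcα n hn
  have hm := hcξ n hn
  have hnpos : (0 : ℝ) < n := by exact_mod_cast hn1
  set l := ratIdx α n
  set m := ratIdx ξ n
  have hlm : l ≤ m := by
    have : (l : ℝ) ≤ m := by rw [hl, hm]; gcongr
    exact_mod_cast this
  obtain ⟨d, hd⟩ := Nat.exists_eq_add_of_le hlm
  have h2m : 2 * m ≤ n := by
    have : (2 : ℝ) * m ≤ n := by rw [hm]; nlinarith
    exact_mod_cast this
  obtain ⟨e, he⟩ : ∃ e, n = 2 * l + d + e := ⟨n - (2 * l + d), by omega⟩
  have hl1 : (1 : ℝ) ≤ l := by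
    have : (0 : ℝ) < l := by rw [hl]; positivity
    exact_mod_cast this
  have hdr : (d : ℝ) = (b - a) * n := by
    have : (m : ℝ) = l + d := by exact_mod_cast hd
    rw [hl, hm] at this
    linarith
  have her : (e : ℝ) = (1 - b - a) * n := by
    have : (n : ℝ) = 2 * l + d + e := by exact_mod_cast he
    rw [hl, hdr] at this
    linarith
  have hvn : (l : ℝ) * (l + e) * (d + 1) = v n := by rw [hl, hdr, her]
  have hdn : (d : ℝ) ≤ n := by exact_mod_cast (by omega : d ≤ n)
  have hen : (e : ℝ) ≤ n := by exact_mod_cast (by omega : e ≤ n)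
  have hln : (l : ℝ) ≤ n := by exact_mod_cast (by omega : l ≤ n)
  have hsn : s n ^ 2 = (d + e + 1 : ℝ) ^ 2 + 4 * (l * (d + 1)) := by
    rw [hs, Real.sq_sqrt (by positivity), hl, hdr, her, hD]
    ring
  have hsn0 := hspos n hnpos
  have hrn : 0 < √(n : ℝ) := Real.sqrt_pos.2 hnpos
  have hsum := sum_mul_pSW d e l
  rw [← he, ← hd] at hsum
  have hnr : (2 * l + d + e : ℝ) = n := by rw [he]; push_cast; ring
  rw [hnr] at hsum
  have hbound := abs_swMean_sub_le d e l hsn0 hrn hsn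
  have hk := swKurt_le (Nat.cast_nonneg d) (Nat.cast_nonneg e) hl1 hdn hen hln
  rw [hvn] at hbound hk
  rw [hsum, Real.dist_eq]
  simp only [Function.comp_apply]
  have e1 (X : ℝ) : (n + 1 - (s n - 16 * v n / (8 * s n ^ 3))) / 2 - n * μ
      - (((n : ℝ) + 1 - X) / 2 - n * μ) = (X - (s n - 16 * v n / (8 * s n ^ 3))) / 2 := by ring
  rw [e1, abs_div, abs_of_pos (show (0 : ℝ) < 2 by norm_num)]
  gcongr
  exact hbound.trans (by gcongr)
end

section
/- Fix rationals α, ξ with 0 < α < ξ ≤ 1/2, and set D := 1 − 4α(1−ξ), μ := (1 − √D)/2 and σ² := α(ξ−α)(1−ξ)/D. For each n such that l := αn and m := ξn are integers, let X_n be a random variable with probability mass function p_{n,m,l}. Then E[((X_n − nμ)/√n)²] → σ² as n → ∞ along such n, and moreover for every integer j ≥ 3 the moments E[|(X_n − nμ)/√n|^j] remain bounded as n → ∞ along such n. -/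
/-- The expectation of `f` under the weights `pSW n m l` on `{0, …, l}`. -/
noncomputable def swE (n m l : ℕ) (f : ℕ → ℝ) : ℝ :=
  ∑ x ∈ Finset.range (l + 1), f x * pSW n m l x

/-- The up rate of a birth-death chain that is reversible with respect to `pSW n m l`. -/
noncomputable def swUp (n m l x : ℝ) : ℝ :=
  (l - x) * (n - x + 1) * (n - m - x) / ((n - 2 * x + 1) * (n - 2 * x))

/-- The down rate of a birth-death chain that is reversible with respect to `pSW n m l`. -/
noncomputable def swDown (n m l x : ℝ) : ℝ :=
  x * (m - x + 1) * (n - l - x + 1) / ((n - 2 * x + 1) * (n - 2 * x + 2))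

/-- The Casimir variable `x (n + 1 - x)`, centred at its mean `l (n - m)`. -/
def swZ (n m l x : ℝ) : ℝ := x * (n + 1 - x) - l * (n - m)

lemma swE_mono {n m l : ℕ} (hm : 2 * m ≤ n) (hl : l < m) {f g : ℕ → ℝ}
    (h : ∀ x ≤ l, f x ≤ g x) : swE n m l f ≤ swE n m l g := by
  refine Finset.sum_le_sum fun x hx => ?_
  have hx : x ≤ l := by simpa [Nat.lt_succ_iff] using hx
  refine mul_le_mul_of_nonneg_right (h x hx) ?_
  have h1 : (2 * x : ℝ) ≤ n := by exact_mod_cast (by omega : 2 * x ≤ n)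
  have h2 : (0 : ℝ) ≤ x := by positivity
  have h3 : (0 : ℝ) ≤ (n : ℝ) - 2 * x + 1 := by linarith
  have h4 : (0 : ℝ) ≤ (n : ℝ) - x + 1 := by linarith
  unfold pSW
  positivity

lemma swE_congr {n m l : ℕ} {f g : ℕ → ℝ} (h : ∀ x ≤ l, f x = g x) :
    swE n m l f = swE n m l g := by
  refine Finset.sum_congr rfl fun x hx => ?_
  rw [h x (by simpa [Nat.lt_succ_iff] using hx)]

lemma swE_add (n m l : ℕ) (f g : ℕ → ℝ) :
    swE n m l (fun x => f x + g x) = swE n m l f + swE n m l g := by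
  simp [swE, add_mul, Finset.sum_add_distrib]

lemma swE_const_mul (n m l : ℕ) (c : ℝ) (f : ℕ → ℝ) :
    swE n m l (fun x => c * f x) = c * swE n m l f := by
  simp [swE, mul_assoc, Finset.mul_sum]

lemma pSW_detailed_balance {n m l x : ℕ} (hm : 2 * m ≤ n) (hl : l < m) (hx : x < l) :
    pSW n m l x * swUp n m l x = pSW n m l (x + 1) * swDown n m l ((x + 1 : ℕ) : ℝ) := by
  have e1 : (n.choose (x + 1) : ℝ) * (x + 1) = n.choose x * (n - x) := by
    have := Nat.choose_succ_right_eq n x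
    rw [← Nat.cast_sub (by omega)]; exact_mod_cast this
  have e2 : (l.choose (x + 1) : ℝ) * (x + 1) = l.choose x * (l - x) := by
    have := Nat.choose_succ_right_eq l x
    rw [← Nat.cast_sub (by omega)]; exact_mod_cast this
  have e3 : (m.choose (x + 1) : ℝ) * (x + 1) = m.choose x * (m - x) := by
    have := Nat.choose_succ_right_eq m x
    rw [← Nat.cast_sub (by omega)]; exact_mod_cast this
  have e4 : ((n - l - (x + 1)).choose (m - l) : ℝ) * (n - l - x)
      = (n - l - x).choose (m - l) * (n - m - x) := by
    obtain ⟨k, hk⟩ : ∃ k, n - l - x = k + 1 := ⟨n - l - x - 1, by omega⟩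
    have h := Nat.choose_mul_succ_eq k (m - l)
    rw [← hk, show n - l - x - (m - l) = n - m - x by omega,
      show k = n - l - (x + 1) by omega] at h
    have h' : ((n - l - (x + 1)).choose (m - l) : ℝ) * ((n - l - x : ℕ) : ℝ)
      = (n - l - x).choose (m - l) * ((n - m - x : ℕ) : ℝ) := by exact_mod_cast h
    rwa [Nat.cast_sub (by omega), Nat.cast_sub (by omega), Nat.cast_sub (by omega),
      Nat.cast_sub (by omega)] at h'
  have c3 : (0 : ℝ) < m.choose x := by exact_mod_cast Nat.choose_pos (by omega)
  have cM : (0 : ℝ) < n.choose m := by exact_mod_cast Nat.choose_pos (by omega)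
  have hm' : (2 * m : ℝ) ≤ n := by exact_mod_cast hm
  have hl' : (l + 1 : ℝ) ≤ m := by exact_mod_cast hl
  have hx' : (x + 1 : ℝ) ≤ l := by exact_mod_cast hx
  have hx0 : (0 : ℝ) ≤ x := by positivity
  unfold pSW swUp swDown
  push_cast
  have p1 : (0 : ℝ) < x + 1 := by linarith
  have p2 : (0 : ℝ) < m - x := by linarith
  have p3 : (0 : ℝ) < n - l - x := by linarith
  have p4 : (0 : ℝ) < n - x := by linarith
  have p5 : (0 : ℝ) < n - x + 1 := by linarith
  have p6 : (0 : ℝ) < n - 2 * x + 1 := by linarith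
  have p7 : (0 : ℝ) < n - 2 * x := by linarith
  have p8 : (0 : ℝ) < n - 2 * x - 1 := by linarith
  rw [← eq_div_iff p1.ne'] at e1 e2 e3
  rw [← eq_div_iff p3.ne'] at e4
  rw [e1, e2, e3, e4, show (n : ℝ) - (x + 1) + 1 = n - x by ring,
    show (n : ℝ) - 2 * (x + 1) + 1 = n - 2 * x - 1 by ring,
    show (n : ℝ) - 2 * (x + 1) + 2 = n - 2 * x by ring,
    show (m : ℝ) - (x + 1) + 1 = m - x by ring,
    show (n : ℝ) - l - (x + 1) + 1 = n - l - x by ring]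
  field_simp

/-- The generator of the reversible chain integrates to zero. -/
lemma swE_generator {n m l : ℕ} (hm : 2 * m ≤ n) (hl : l < m) (f : ℝ → ℝ) :
    swE n m l (fun x => swUp n m l x * (f (x + 1) - f x)
      + swDown n m l x * (f (x - 1) - f x)) = 0 := by
  rw [swE_add, swE, swE, Finset.sum_range_succ, Finset.sum_range_succ']
  have h1 : swUp n m l l = 0 := by simp [swUp]
  have h2 : swDown n m l ((0 : ℕ) : ℝ) = 0 := by simp [swDown]
  rw [h1, h2]
  simp only [zero_mul, add_zero]
  rw [← Finset.sum_add_distrib]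
  refine Finset.sum_eq_zero fun x hx => ?_
  have h := pSW_detailed_balance hm hl (Finset.mem_range.1 hx)
  rw [show (((x + 1 : ℕ) : ℝ) - 1) = x by push_cast; ring]
  push_cast at h ⊢
  linear_combination (f (x + 1) - f x) * h

section rates
variable {n m l x : ℝ}

lemma swUp_nonneg (h0 : 0 ≤ x) (h1 : x ≤ l) (h2 : l < m) (h3 : 2 * m ≤ n) :
    0 ≤ swUp n m l x :=
  div_nonneg (mul_nonneg (mul_nonneg (by linarith) (by linarith)) (by linarith))
    (mul_nonneg (by linarith) (by linarith))

lemma swDown_nonneg (h0 : 0 ≤ x) (h1 : x ≤ l) (h2 : l < m) (h3 : 2 * m ≤ n) :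
    0 ≤ swDown n m l x :=
  div_nonneg (mul_nonneg (mul_nonneg (by linarith) (by linarith)) (by linarith))
    (mul_nonneg (by linarith) (by linarith))

lemma swZ_drift (h1 : x ≤ l) (h2 : l < m) (h3 : 2 * m ≤ n) :
    swUp n m l x * (n - 2 * x) - swDown n m l x * (n - 2 * x + 2) = -swZ n m l x := by
  obtain ⟨t, rfl⟩ : ∃ t, n = t + 2 * x := ⟨n - 2 * x, by ring⟩
  have ht : 0 < t := by linarith
  unfold swUp swDown swZ
  rw [show t + 2 * x - 2 * x = t by ring]
  field_simp
  ring

lemma swZ_diffusion (h1 : x ≤ l) (h2 : l < m) (h3 : 2 * m ≤ n) :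
    swUp n m l x * (n - 2 * x) ^ 2 + swDown n m l x * (n - 2 * x + 2) ^ 2
      = 2 * (l * (n - m) * (m - l + 1)) - (n - 2 * (m - l) - 2) * swZ n m l x := by
  obtain ⟨t, rfl⟩ : ∃ t, n = t + 2 * x := ⟨n - 2 * x, by ring⟩
  have ht : 0 < t := by linarith
  unfold swUp swDown swZ
  rw [show t + 2 * x - 2 * x = t by ring]
  field_simp
  ring

lemma swZ_diffusion_le (hn : 1 ≤ n) (h0 : 0 ≤ x) (h1 : x ≤ l) (h2 : l < m) (h3 : 2 * m ≤ n) :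
    swUp n m l x * (n - 2 * x) ^ 2 + swDown n m l x * (n - 2 * x + 2) ^ 2 ≤ 10 * n ^ 3 := by
  have p6 : 0 < n - 2 * x + 1 := by linarith
  have p7 : 0 < n - 2 * x := by linarith
  have p8 : 0 < n - 2 * x + 2 := by linarith
  have e : swUp n m l x * (n - 2 * x) ^ 2 + swDown n m l x * (n - 2 * x + 2) ^ 2
      = ((l - x) * (n - x + 1) * (n - m - x) * (n - 2 * x)
        + x * (m - x + 1) * (n - l - x + 1) * (n - 2 * x + 2)) / (n - 2 * x + 1) := by
    unfold swUp swDown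
    field_simp
  rw [e, div_le_iff₀ p6]
  have a1 : (l - x) * (n - x + 1) * (n - m - x) * (n - 2 * x)
      ≤ n * (2 * n) * n * (n - 2 * x + 1) :=
    mul_le_mul (mul_le_mul (mul_le_mul (by linarith) (by linarith) (by linarith) (by linarith))
      (by linarith) (by linarith) (by positivity)) (by linarith) (by linarith) (by positivity)
  have a2 : x * (m - x + 1) * (n - l - x + 1) * (n - 2 * x + 2)
      ≤ n * (2 * n) * (2 * n) * (2 * (n - 2 * x + 1)) :=
    mul_le_mul (mul_le_mul (mul_le_mul (by linarith) (by linarith) (by linarith) (by linarith))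
      (by linarith) (by linarith) (by positivity)) (by linarith) (by linarith) (by positivity)
  linarith

end rates

lemma swZ_add_one (n m l x : ℝ) : swZ n m l (x + 1) = swZ n m l x + (n - 2 * x) := by
  unfold swZ; ring

lemma swZ_sub_one (n m l x : ℝ) : swZ n m l (x - 1) = swZ n m l x - (n - 2 * x + 2) := by
  unfold swZ; ring

lemma sw_cast {n m l x : ℕ} (hm : 2 * m ≤ n) (hl : l < m) (hx : x ≤ l) :
    (1 : ℝ) ≤ n ∧ (0 : ℝ) ≤ x ∧ (x : ℝ) ≤ l ∧ (l : ℝ) < m ∧ (2 * m : ℝ) ≤ n := by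
  refine ⟨?_, ?_, ?_, ?_, ?_⟩ <;> norm_cast <;> omega

lemma swE_swZ {n m l : ℕ} (hm : 2 * m ≤ n) (hl : l < m) :
    swE n m l (fun x => swZ n m l x) = 0 := by
  have h := swE_generator hm hl (swZ n m l)
  have h2 : swE n m l (fun x => swUp n m l x * (swZ n m l (x + 1) - swZ n m l x)
      + swDown n m l x * (swZ n m l (x - 1) - swZ n m l x))
      = swE n m l (fun x => (-1) * swZ n m l x) := by
    refine swE_congr fun x hx => ?_
    obtain ⟨-, h0, h1, h2, h3⟩ := sw_cast hm hl hx
    have := swZ_drift h1 h2 h3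
    rw [swZ_add_one, swZ_sub_one]
    linear_combination this
  rw [h, swE_const_mul] at h2
  linarith

/-- The weights `pSW n m l` sum to one. -/
lemma swE_one {n m : ℕ} (hm : 2 * m ≤ n) :
    ∀ {l : ℕ}, l < m → swE n m l (fun _ => 1) = 1 := by
  intro l
  induction l with
  | zero =>
    intro h
    have cM : (0 : ℝ) < n.choose m := by exact_mod_cast Nat.choose_pos (by omega)
    have : (n : ℝ) + 1 ≠ 0 := by positivity
    simp [swE, pSW]
    field_simp
  | succ l ih =>
    intro hl
    have ih := ih (by omega)
    have key : ∀ x ∈ Finset.range (l + 1), (((l : ℝ) + 1) * (m - l)) * (1 * pSW n m l x)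
        = (((l : ℝ) + 1) * (m - l)) * (1 * pSW n m (l + 1) x)
          - swZ n m ((l + 1 : ℕ) : ℝ) x * pSW n m (l + 1) x := by
      intro x hx
      have hx : x ≤ l := by simpa [Nat.lt_succ_iff] using hx
      have e2 : ((l + 1).choose x : ℝ) * (l + 1 - x) = l.choose x * (l + 1) := by
        have := Nat.choose_mul_succ_eq l x
        rw [show (l : ℝ) + 1 - x = ((l + 1 - x : ℕ) : ℝ) by
          rw [Nat.cast_sub (by omega)]; push_cast; rfl]
        exact_mod_cast this.symm
      have e4 : ((n - (l + 1) - x).choose (m - (l + 1)) : ℝ) * (n - l - x)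
          = (n - l - x).choose (m - l) * (m - l) := by
        obtain ⟨k, hk⟩ : ∃ k, n - l - x = k + 1 := ⟨n - l - x - 1, by omega⟩
        obtain ⟨r, hr⟩ : ∃ r, m - l = r + 1 := ⟨m - l - 1, by omega⟩
        have h := Nat.add_one_mul_choose_eq k r
        rw [← hk, ← hr, show r = m - (l + 1) by omega,
          show k = n - (l + 1) - x by omega] at h
        have h' : ((n - l - x : ℕ) : ℝ) * ((n - (l + 1) - x).choose (m - (l + 1)) : ℝ)
          = (n - l - x).choose (m - l) * ((m - l : ℕ) : ℝ) := by exact_mod_cast h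
        rw [Nat.cast_sub (by omega), Nat.cast_sub (by omega), Nat.cast_sub (by omega)] at h'
        linarith
      have hm' : (2 * m : ℝ) ≤ n := by exact_mod_cast hm
      have hl' : (l + 1 + 1 : ℝ) ≤ m := by exact_mod_cast hl
      have hx' : (x : ℝ) ≤ l := by exact_mod_cast hx
      have hx0 : (0 : ℝ) ≤ x := by positivity
      unfold pSW swZ
      push_cast
      generalize hA : ((n.choose x : ℝ) / n.choose m) = A
      generalize hB : ((n : ℝ) - 2 * x + 1) / (n - x + 1) = B
      linear_combination (-A * B / (m.choose x : ℝ)) *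
        (((n - l - x).choose (m - l) : ℝ) * (m - l) * e2
          + ((l + 1).choose x : ℝ) * (l + 1 - x) * e4)
    have hZ := swE_swZ hm hl
    have hZl : swZ n m ((l + 1 : ℕ) : ℝ) ((l + 1 : ℕ) : ℝ) = (l + 1) * (m - l) := by
      unfold swZ; push_cast; ring
    have hs := Finset.sum_congr rfl key
    simp only [one_mul] at hs
    rw [Finset.sum_sub_distrib, ← Finset.mul_sum, ← Finset.mul_sum] at hs
    simp only [swE, one_mul] at ih hZ ⊢
    rw [Finset.sum_range_succ] at hZ ⊢
    rw [hZl] at hZ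
    rw [ih] at hs
    have hl' : (l + 1 + 1 : ℝ) ≤ m := by exact_mod_cast hl
    have hpos : (0 : ℝ) < (l + 1) * (m - l) := mul_pos (by positivity) (by linarith)
    have : ((l + 1 : ℝ) * (m - l)) ≠ 0 := hpos.ne'
    apply mul_left_cancel₀ this
    linarith

lemma swE_swZ_sq {n m l : ℕ} (hm : 2 * m ≤ n) (hl : l < m) :
    swE n m l (fun x => swZ n m l x ^ 2) = l * (n - m) * (m - l + 1) := by
  have h := swE_generator hm hl (fun x => swZ n m l x ^ 2)
  have h2 : swE n m l (fun x => swUp n m l x * (swZ n m l (x + 1) ^ 2 - swZ n m l x ^ 2)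
      + swDown n m l x * (swZ n m l (x - 1) ^ 2 - swZ n m l x ^ 2))
      = swE n m l (fun x => ((-2) * swZ n m l x ^ 2 + 2 * (l * (n - m) * (m - l + 1)) * 1)
        + (-(n - 2 * (m - l) - 2)) * swZ n m l x) := by
    refine swE_congr fun x hx => ?_
    obtain ⟨-, h0, h1, h2, h3⟩ := sw_cast hm hl hx
    have e1 := swZ_drift h1 h2 h3
    have e2 := swZ_diffusion h1 h2 h3
    rw [swZ_add_one, swZ_sub_one]
    linear_combination 2 * swZ n m l x * e1 + e2
  rw [h, swE_add, swE_add, swE_const_mul, swE_const_mul, swE_const_mul, swE_swZ hm hl,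
    swE_one hm hl] at h2
  linarith

/-- Second-order Taylor bound for powers. -/
lemma exists_pow_taylor_bound (k : ℕ) : ∃ C : ℝ, 0 ≤ C ∧ ∀ z δ : ℝ,
    |(z + δ) ^ (k + 2) - z ^ (k + 2) - (k + 2) * δ * z ^ (k + 1)|
      ≤ C * (δ ^ 2 * (|z| + |δ|) ^ k) := by
  induction k with
  | zero =>
    refine ⟨1, by norm_num, fun z δ => le_of_eq ?_⟩
    have : (z + δ) ^ (0 + 2) - z ^ (0 + 2) - ((0 : ℕ) + 2) * δ * z ^ (0 + 1) = δ ^ 2 := by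
      push_cast; ring
    rw [this]
    simp
  | succ k ih =>
    obtain ⟨C, hC, h⟩ := ih
    refine ⟨C + (k + 2), by positivity, fun z δ => ?_⟩
    have e : (z + δ) ^ (k + 1 + 2) - z ^ (k + 1 + 2) - ((k + 1 : ℕ) + 2) * δ * z ^ (k + 1 + 1)
        = (z + δ) * ((z + δ) ^ (k + 2) - z ^ (k + 2) - (k + 2) * δ * z ^ (k + 1))
          + (k + 2) * (δ ^ 2 * z ^ (k + 1)) := by
      push_cast; ring
    rw [e]
    have h1 : |z + δ| ≤ |z| + |δ| := abs_add_le z δ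
    have h2 : |z| ^ (k + 1) ≤ (|z| + |δ|) ^ (k + 1) := by
      gcongr; linarith [abs_nonneg δ]
    calc _ ≤ |z + δ| * |(z + δ) ^ (k + 2) - z ^ (k + 2) - (k + 2) * δ * z ^ (k + 1)|
          + (k + 2) * (δ ^ 2 * |z| ^ (k + 1)) := by
          refine (abs_add_le _ _).trans (le_of_eq ?_)
          rw [abs_mul, abs_mul, abs_mul, abs_pow z, abs_of_nonneg (sq_nonneg δ),
            abs_of_nonneg (by positivity : (0 : ℝ) ≤ k + 2)]
      _ ≤ (|z| + |δ|) * (C * (δ ^ 2 * (|z| + |δ|) ^ k))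
          + (k + 2) * (δ ^ 2 * (|z| + |δ|) ^ (k + 1)) := by
          gcongr
          exact h z δ
      _ = _ := by ring

/-- The centred Casimir variable, rescaled by `n ^ (3/2)`. -/
noncomputable def swU (n m l : ℕ) (x : ℝ) : ℝ := swZ n m l x / Real.sqrt n ^ 3

lemma abs_div_sqrt_cube_le_three {n : ℕ} {y : ℝ} (hn : (1 : ℝ) ≤ n) (h0 : 0 ≤ y)
    (h1 : y ≤ 3 * n) : |y / Real.sqrt n ^ 3| ≤ 3 := by
  have hs : 1 ≤ Real.sqrt n := Real.one_le_sqrt.2 hn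
  have hs2 : Real.sqrt n ^ 2 = n := Real.sq_sqrt (by linarith)
  rw [abs_of_nonneg (by positivity), div_le_iff₀ (by positivity)]
  nlinarith

lemma swU_generator_le (k : ℕ) : ∃ C : ℝ, 0 ≤ C ∧ ∀ n m l x : ℕ, 2 * m ≤ n → l < m → x ≤ l →
    swUp n m l x * (swU n m l (x + 1) ^ (2 * k + 2) - swU n m l x ^ (2 * k + 2))
      + swDown n m l x * (swU n m l (x - 1) ^ (2 * k + 2) - swU n m l x ^ (2 * k + 2))
      ≤ (-((2 * k + 2 : ℝ))) * swU n m l x ^ (2 * k + 2) + C * swU n m l x ^ (2 * k) + C := by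
  obtain ⟨C, hC, h⟩ := exists_pow_taylor_bound (2 * k)
  refine ⟨C * 10 * 2 ^ (2 * k - 1) * 3 ^ (2 * k), by positivity, fun n m l x hm hl hx => ?_⟩
  obtain ⟨hn, h0, h1, h2, h3⟩ := sw_cast hm hl hx
  have hs : 1 ≤ Real.sqrt n := Real.one_le_sqrt.2 hn
  have hs2 : Real.sqrt n ^ 2 = n := Real.sq_sqrt (by linarith)
  set s := Real.sqrt n with hsdef
  have hU := swUp_nonneg h0 h1 h2 h3
  have hD := swDown_nonneg h0 h1 h2 h3
  have e1 := swZ_drift h1 h2 h3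
  have e2 := swZ_diffusion_le hn h0 h1 h2 h3
  have u1 : swU n m l (x + 1) = swU n m l x + (n - 2 * x) / s ^ 3 := by
    simp only [swU, swZ_add_one]; ring
  have u2 : swU n m l (x - 1) = swU n m l x + (-((n - 2 * x + 2) / s ^ 3)) := by
    simp only [swU, swZ_sub_one]; ring
  have uz : swU n m l x = swZ n m l x / s ^ 3 := rfl
  rw [u1, u2]
  set a : ℝ := (n - 2 * x) / s ^ 3 with ha
  set b : ℝ := (n - 2 * x + 2) / s ^ 3 with hb
  set u := swU n m l x with hu
  set p := swUp n m l x
  set q := swDown n m l x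
  have a2 : |a| ≤ 3 := abs_div_sqrt_cube_le_three hn (by linarith) (by linarith)
  have b2 : |-b| ≤ 3 := by
    rw [abs_neg]; exact abs_div_sqrt_cube_le_three hn (by linarith) (by linarith)
  have d1 : p * a - q * b = -u := by
    rw [uz, ha, hb, ← neg_div, ← e1]; ring
  have d2 : p * a ^ 2 + q * b ^ 2 ≤ 10 := by
    have : p * a ^ 2 + q * b ^ 2 = (p * (n - 2 * x) ^ 2 + q * (n - 2 * x + 2) ^ 2) / n ^ 3 := by
      rw [ha, hb, ← hs2]; ring
    rw [this, div_le_iff₀ (by positivity)]; exact e2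
  have pw : (|u| + 3) ^ (2 * k) ≤ 2 ^ (2 * k - 1) * (u ^ (2 * k) + 3 ^ (2 * k)) := by
    have := add_pow_le (abs_nonneg u) (by norm_num : (0 : ℝ) ≤ 3) (2 * k)
    rwa [Even.pow_abs (even_two_mul k)] at this
  have t1 : (u + a) ^ (2 * k + 2) - u ^ (2 * k + 2)
      ≤ (2 * k + 2) * a * u ^ (2 * k + 1) + C * (a ^ 2 * (|u| + 3) ^ (2 * k)) := by
    have := (abs_le.1 (h u a)).2
    have h' : C * (a ^ 2 * (|u| + |a|) ^ (2 * k)) ≤ C * (a ^ 2 * (|u| + 3) ^ (2 * k)) := by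
      gcongr
    push_cast at this
    linarith
  have t2 : (u + -b) ^ (2 * k + 2) - u ^ (2 * k + 2)
      ≤ (2 * k + 2) * (-b) * u ^ (2 * k + 1) + C * (b ^ 2 * (|u| + 3) ^ (2 * k)) := by
    have := (abs_le.1 (h u (-b))).2
    have h' : C * ((-b) ^ 2 * (|u| + |-b|) ^ (2 * k)) ≤ C * ((-b) ^ 2 * (|u| + 3) ^ (2 * k)) := by
      gcongr
    rw [neg_sq] at h' this
    push_cast at this
    linarith
  have hk : (0 : ℝ) ≤ u ^ (2 * k) := Even.pow_nonneg (even_two_mul k) u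
  have hk2 : (1 : ℝ) ≤ 3 ^ (2 * k) := one_le_pow₀ (by norm_num)
  calc _ ≤ p * ((2 * k + 2) * a * u ^ (2 * k + 1) + C * (a ^ 2 * (|u| + 3) ^ (2 * k)))
        + q * ((2 * k + 2) * (-b) * u ^ (2 * k + 1) + C * (b ^ 2 * (|u| + 3) ^ (2 * k))) := by
        gcongr
    _ = (2 * k + 2) * u ^ (2 * k + 1) * (p * a - q * b)
        + C * ((|u| + 3) ^ (2 * k) * (p * a ^ 2 + q * b ^ 2)) := by ring
    _ ≤ (2 * k + 2) * u ^ (2 * k + 1) * (-u)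
        + C * ((2 ^ (2 * k - 1) * (u ^ (2 * k) + 3 ^ (2 * k))) * 10) := by
        rw [d1]
        have : 0 ≤ p * a ^ 2 + q * b ^ 2 := by positivity
        gcongr
    _ = (-(2 * k + 2)) * u ^ (2 * k + 2) + C * 10 * 2 ^ (2 * k - 1) * u ^ (2 * k)
        + C * 10 * 2 ^ (2 * k - 1) * 3 ^ (2 * k) := by ring
    _ ≤ _ := by
        have := mul_le_mul_of_nonneg_right (le_mul_of_one_le_right
          (by positivity : 0 ≤ C * 10 * 2 ^ (2 * k - 1)) hk2) hk
        linarith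

lemma exists_swE_swU_even_le (k : ℕ) : ∃ C : ℝ, ∀ n m l : ℕ, 2 * m ≤ n → l < m →
    swE n m l (fun x => swU n m l x ^ (2 * k)) ≤ C := by
  induction k with
  | zero =>
    refine ⟨1, fun n m l hm hl => ?_⟩
    simpa using (swE_one hm hl).le
  | succ k ih =>
    obtain ⟨B, hB⟩ := ih
    obtain ⟨C, hC, h⟩ := swU_generator_le k
    refine ⟨C * B + C, fun n m l hm hl => ?_⟩
    have g := swE_generator hm hl (fun x => swU n m l x ^ (2 * k + 2))
    have g2 := swE_mono hm hl (fun x hx => h n m l x hm hl hx)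
    have c1 : swE n m l (fun _ => C) = C := by
      have := swE_const_mul n m l C (fun _ => 1)
      rw [swE_one hm hl] at this
      simpa using this
    rw [g, swE_add, swE_add, swE_const_mul, swE_const_mul, c1] at g2
    have hb := mul_le_mul_of_nonneg_left (hB n m l hm hl) hC
    have pos : 0 ≤ swE n m l (fun x => swU n m l x ^ (2 * k + 2)) := by
      have := swE_mono hm hl (f := fun _ => 0) (g := fun x => swU n m l x ^ (2 * k + 2))
        (fun x _ => Even.pow_nonneg ⟨k + 1, by ring⟩ _)
      simpa [swE] using this
    rw [show 2 * (k + 1) = 2 * k + 2 by ring]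
    nlinarith [mul_nonneg (Nat.cast_nonneg (α := ℝ) k) pos]

lemma exists_swE_abs_swU_le (j : ℕ) : ∃ C : ℝ, ∀ n m l : ℕ, 2 * m ≤ n → l < m →
    swE n m l (fun x => |swU n m l x| ^ j) ≤ C := by
  obtain ⟨C, h⟩ := exists_swE_swU_even_le j
  refine ⟨1 + C, fun n m l hm hl => ?_⟩
  have := swE_mono hm hl (f := fun x => |swU n m l x| ^ j)
    (g := fun x => 1 + swU n m l x ^ (2 * j)) (fun x _ => by
      have e : swU n m l x ^ (2 * j) = (|swU n m l x| ^ j) ^ 2 := by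
        rw [← Even.pow_abs (even_two_mul j)]; ring
      rw [e]
      nlinarith [sq_nonneg (|swU n m l x| ^ j - 1)])
  rw [swE_add, swE_one hm hl] at this
  linarith [h n m l hm hl]

section standardized
variable {n m l x : ℕ} {a c r μ : ℝ}

/-- The linearization of the Casimir variable around the root `μ` of `t - t² = a (1 - c)`. -/
lemma standardized_linearization (hn : (1 : ℝ) ≤ n) (hl : (l : ℝ) = a * n)
    (hm : (m : ℝ) = c * n) (hr : r = 1 - 2 * μ) (hμ : μ - μ ^ 2 = a * (1 - c)) :
    r * ((x - n * μ) / Real.sqrt n) = swU n m l x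
      + ((((x : ℝ) - n * μ) / Real.sqrt n) ^ 2 - x / n) / Real.sqrt n := by
  have hs : 1 ≤ Real.sqrt n := Real.one_le_sqrt.2 hn
  have hs2 : (n : ℝ) = Real.sqrt n ^ 2 := (Real.sq_sqrt (by linarith)).symm
  unfold swU swZ
  rw [hl, hm, hr]
  generalize Real.sqrt n = s at *
  rw [hs2]
  field_simp
  linear_combination (-s ^ 4) * hμ

lemma abs_standardized_le (hn : (1 : ℝ) ≤ n) (hl : (l : ℝ) = a * n)
    (hm : (m : ℝ) = c * n) (hr0 : 0 ≤ r) (hr : r = 1 - 2 * μ) (hμ : μ - μ ^ 2 = a * (1 - c))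
    (ha : a < 1 / 2) (hx : x ≤ l) :
    |((x : ℝ) - n * μ) / Real.sqrt n| ≤ (|swU n m l x| + 1) / (1 / 2 - a) := by
  have hs : 1 ≤ Real.sqrt n := Real.one_le_sqrt.2 hn
  have hs2 : Real.sqrt n ^ 2 = (n : ℝ) := Real.sq_sqrt (by linarith)
  have h := standardized_linearization (x := x) hn hl hm hr hμ
  have hx' : (x : ℝ) ≤ l := by exact_mod_cast hx
  have hw : (x : ℝ) / n ≤ a := by
    rw [div_le_iff₀ (by linarith)]; linarith
  have hw0 : 0 ≤ (x : ℝ) / n := by positivity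
  have hV : ((x : ℝ) - n * μ) / Real.sqrt n / Real.sqrt n = x / n - μ := by
    rw [div_div, ← sq, hs2, sub_div, mul_div_cancel_left₀ _ (by linarith)]
  set V := ((x : ℝ) - n * μ) / Real.sqrt n
  have e : V * (1 - μ - x / n) = swU n m l x - x / n / Real.sqrt n := by
    linear_combination h - V * hr + V * hV
  have hq0 : 0 ≤ (x : ℝ) / n / Real.sqrt n := by positivity
  have hq1 : (x : ℝ) / n / Real.sqrt n ≤ 1 := by
    rw [div_le_one (by linarith)]; linarith
  rw [le_div_iff₀ (by linarith)]
  calc |V| * (1 / 2 - a) ≤ |V| * (1 - μ - x / n) := by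
        gcongr; linarith
    _ = |swU n m l x - x / n / Real.sqrt n| := by
        rw [← e, abs_mul, abs_of_nonneg (by linarith : 0 ≤ 1 - μ - (x : ℝ) / n)]
    _ ≤ |swU n m l x| + |(x : ℝ) / n / Real.sqrt n| := abs_sub _ _
    _ ≤ |swU n m l x| + 1 := by rw [abs_of_nonneg hq0]; linarith

end standardized

lemma exists_swE_abs_standardized_le (j : ℕ) {a c r μ : ℝ} (hr0 : 0 ≤ r) (hr : r = 1 - 2 * μ)
    (hμ : μ - μ ^ 2 = a * (1 - c)) (ha : a < 1 / 2) :
    ∃ B : ℝ, ∀ n m l : ℕ, 2 * m ≤ n → l < m → (l : ℝ) = a * n → (m : ℝ) = c * n →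
      swE n m l (fun x => |((x : ℝ) - n * μ) / Real.sqrt n| ^ j) ≤ B := by
  obtain ⟨C, hC⟩ := exists_swE_abs_swU_le j
  have hk : 0 < 1 / 2 - a := by linarith
  refine ⟨2 ^ (j - 1) / (1 / 2 - a) ^ j * (C + 1), fun n m l hm hl el em => ?_⟩
  have hle := swE_mono hm hl (f := fun x => |((x : ℝ) - n * μ) / Real.sqrt n| ^ j)
    (g := fun x => 2 ^ (j - 1) / (1 / 2 - a) ^ j * (|swU n m l x| ^ j + 1)) (fun x hx => by
      have hn := (sw_cast hm hl hx).1
      calc _ ≤ ((|swU n m l x| + 1) / (1 / 2 - a)) ^ j := by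
            gcongr
            exact abs_standardized_le hn el em hr0 hr hμ ha hx
        _ = (|swU n m l x| + 1) ^ j / (1 / 2 - a) ^ j := div_pow _ _ _
        _ ≤ (2 ^ (j - 1) * (|swU n m l x| ^ j + 1 ^ j)) / (1 / 2 - a) ^ j := by
            gcongr
            exact add_pow_le (abs_nonneg _) zero_le_one j
        _ = _ := by rw [one_pow]; ring)
  rw [swE_const_mul, swE_add, swE_one hm hl] at hle
  refine hle.trans ?_
  gcongr
  exact hC n m l hm hl

lemma abs_sq_sub_sq_le_of_perturbation {r t u v w : ℝ} (ht0 : 0 ≤ t) (ht1 : t ≤ 1)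
    (hw0 : 0 ≤ w) (hw1 : w ≤ 1) (h : r * v = u + (v ^ 2 - w) * t) :
    |r ^ 2 * v ^ 2 - u ^ 2| ≤ t * (u ^ 2 + 4 * v ^ 4 + 4) := by
  have e : r ^ 2 * v ^ 2 - u ^ 2 = t * (2 * u * (v ^ 2 - w) + t * (v ^ 2 - w) ^ 2) := by
    rw [← mul_pow, h]; ring
  have hR : (v ^ 2 - w) ^ 2 ≤ 2 * v ^ 4 + 2 := by nlinarith [sq_nonneg (v ^ 2 + w)]
  have hR0 : 0 ≤ (v ^ 2 - w) ^ 2 := sq_nonneg _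
  have hv : 0 ≤ v ^ 4 := by positivity
  have htR : t * (v ^ 2 - w) ^ 2 ≤ (v ^ 2 - w) ^ 2 := mul_le_of_le_one_left hR0 ht1
  have htR0 : 0 ≤ t * (v ^ 2 - w) ^ 2 := mul_nonneg ht0 hR0
  rw [e, abs_mul, abs_of_nonneg ht0]
  generalize v ^ 2 - w = R at *
  have h1 : 0 ≤ u ^ 2 + 2 * u * R + R ^ 2 := by rw [← add_sq]; exact sq_nonneg _
  have h2 : 0 ≤ u ^ 2 - 2 * u * R + R ^ 2 := by rw [← sub_sq]; exact sq_nonneg _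
  refine mul_le_mul_of_nonneg_left (abs_le.2 ⟨?_, ?_⟩) ht0 <;> linarith

/-- The second moment of the standardized variable, up to an error of order `n ^ (-1/2)`. -/
lemma exists_swE_standardized_sq_error {a c r μ : ℝ} (ha0 : 0 < a) (hac : a < c)
    (hc : c ≤ 1 / 2) (hr0 : 0 < r) (hr : r = 1 - 2 * μ) (hμ : μ - μ ^ 2 = a * (1 - c)) :
    ∃ K : ℝ, ∀ n m l : ℕ, 2 * m ≤ n → l < m → (l : ℝ) = a * n → (m : ℝ) = c * n →
      |swE n m l (fun x => (((x : ℝ) - n * μ) / Real.sqrt n) ^ 2)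
        - a * (c - a) * (1 - c) / r ^ 2| ≤ K / Real.sqrt n := by
  obtain ⟨C, hC⟩ := exists_swE_abs_swU_le 2
  obtain ⟨B, hB⟩ := exists_swE_abs_standardized_le 4 hr0.le hr hμ (by linarith)
  refine ⟨(C + 4 * B + 4 + 1) / r ^ 2, fun n m l hm hl el em => ?_⟩
  have hn := (sw_cast hm hl le_rfl).1
  have hs : 1 ≤ Real.sqrt n := Real.one_le_sqrt.2 hn
  have hs2 : Real.sqrt n ^ 2 = (n : ℝ) := Real.sq_sqrt (by linarith)
  have hU : swE n m l (fun x => swU n m l x ^ 2) = a * (c - a) * (1 - c) + a * (1 - c) / n := by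
    have h : swE n m l (fun x => swU n m l x ^ 2)
        = swE n m l (fun x => ((n : ℝ) ^ 3)⁻¹ * swZ n m l x ^ 2) :=
      swE_congr fun x _ => by
        rw [swU, show (n : ℝ) ^ 3 = (Real.sqrt n ^ 3) ^ 2 by rw [← pow_mul, mul_comm, pow_mul, hs2]]
        ring
    rw [h, swE_const_mul, swE_swZ_sq hm hl, el, em]
    field_simp
  have hpt : ∀ x ≤ l, |r ^ 2 * (((x : ℝ) - n * μ) / Real.sqrt n) ^ 2 - swU n m l x ^ 2|
      ≤ (Real.sqrt n)⁻¹ * (|swU n m l x| ^ 2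
        + 4 * |((x : ℝ) - n * μ) / Real.sqrt n| ^ 4 + 4 * 1) := by
    intro x hx
    have h := standardized_linearization (x := x) hn el em hr hμ
    have hx' : (x : ℝ) ≤ l := by exact_mod_cast hx
    have hw : (x : ℝ) / n ≤ 1 := by
      rw [div_le_iff₀ (by linarith)]; nlinarith
    have hw0 : 0 ≤ (x : ℝ) / n := by positivity
    rw [sq_abs, Even.pow_abs (by decide : Even 4), mul_one]
    rw [div_eq_mul_inv _ (Real.sqrt n)] at h
    exact abs_sq_sub_sq_le_of_perturbation (by positivity) (inv_le_one_of_one_le₀ hs) hw0 hw h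
  have hE : swE n m l (fun x => (Real.sqrt n)⁻¹ * (|swU n m l x| ^ 2
        + 4 * |((x : ℝ) - n * μ) / Real.sqrt n| ^ 4 + 4 * 1))
      ≤ (Real.sqrt n)⁻¹ * (C + 4 * B + 4) := by
    rw [swE_const_mul, swE_add, swE_add, swE_const_mul, swE_const_mul, swE_one hm hl]
    have := hC n m l hm hl
    have := hB n m l hm hl el em
    gcongr
    norm_num
  have up := swE_mono hm hl (fun x hx => sub_le_iff_le_add.1 (abs_le.1 (hpt x hx)).2)
  have lo := swE_mono hm hl (fun x hx => sub_le_iff_le_add.1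
    ((le_abs_self _).trans ((abs_sub_comm _ _).trans_le (hpt x hx))))
  rw [swE_add, swE_const_mul, hU] at up
  rw [swE_add, swE_const_mul _ _ _ (r ^ 2), hU] at lo
  set Q := swE n m l (fun x => (((x : ℝ) - n * μ) / Real.sqrt n) ^ 2)
  have hw0 : 0 ≤ a * (1 - c) / n := div_nonneg (mul_nonneg ha0.le (by linarith)) (by linarith)
  have hw1 : a * (1 - c) / n ≤ (Real.sqrt n)⁻¹ := by
    rw [div_le_iff₀ (by linarith)]
    have : (Real.sqrt n)⁻¹ * n = Real.sqrt n := by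
      nth_rewrite 2 [← hs2]; field_simp
    rw [this]; nlinarith
  have hr2 : 0 < r ^ 2 := by positivity
  have e : Q - a * (c - a) * (1 - c) / r ^ 2 = (r ^ 2 * Q - a * (c - a) * (1 - c)) / r ^ 2 := by
    field_simp
  rw [e, abs_div, abs_of_pos hr2, div_right_comm]
  refine div_le_div_of_nonneg_right (abs_le.2 ?_) hr2.le
  rw [div_eq_mul_inv]
  constructor <;> linarith

open Filter in
/-- moments: `E[((X_n − nμ)/√n)²] → σ²`, and for every `j ≥ 3`
the moments `E[|(X_n − nμ)/√n|^j]` remain bounded, along those `n` for which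
`αn` and `ξn` are integers. -/
theorem statement_14 (α ξ : ℚ) (h0 : 0 < α) (h1 : α < ξ) (h2 : ξ ≤ 1 / 2)
    (D μ σ2 : ℝ) (hD : D = 1 - 4 * (α : ℝ) * (1 - (ξ : ℝ)))
    (hμ : μ = (1 - Real.sqrt D) / 2)
    (hσ2 : σ2 = (α : ℝ) * ((ξ : ℝ) - (α : ℝ)) * (1 - (ξ : ℝ)) / D) :
    Tendsto (fun n : ℕ =>
        ∑ x ∈ Finset.range (ratIdx α n + 1),
          (((x : ℝ) - n * μ) / Real.sqrt n) ^ 2 * pSW n (ratIdx ξ n) (ratIdx α n) x)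
      (atTop ⊓ Filter.principal (exactSet α ξ)) (nhds σ2) ∧
    ∀ j : ℕ, 3 ≤ j → ∃ B : ℝ,
      ∀ᶠ n : ℕ in atTop ⊓ Filter.principal (exactSet α ξ),
        (∑ x ∈ Finset.range (ratIdx α n + 1),
          |((x : ℝ) - n * μ) / Real.sqrt n| ^ j * pSW n (ratIdx ξ n) (ratIdx α n) x) ≤ B := by
  have ha0 : (0 : ℝ) < α := by exact_mod_cast h0
  have hac : (α : ℝ) < ξ := by exact_mod_cast h1
  have hc : (ξ : ℝ) ≤ 1 / 2 := by
    have : ((ξ : ℚ) : ℝ) ≤ ((1 / 2 : ℚ) : ℝ) := Rat.cast_le.2 h2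
    simpa using this
  have hDpos : 0 < D := by rw [hD]; nlinarith [sq_nonneg (1 - 2 * (ξ : ℝ))]
  have hr0 : 0 < Real.sqrt D := Real.sqrt_pos.2 hDpos
  have hr2 : Real.sqrt D ^ 2 = D := Real.sq_sqrt hDpos.le
  have hr : Real.sqrt D = 1 - 2 * μ := by rw [hμ]; ring
  have hμ2 : μ - μ ^ 2 = α * (1 - ξ) := by
    rw [hμ]; linear_combination (-1 / 4 : ℝ) * hr2 - (1 / 4 : ℝ) * hD
  have hreg : ∀ n : ℕ, 1 ≤ n → n ∈ exactSet α ξ →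
      2 * ratIdx ξ n ≤ n ∧ ratIdx α n < ratIdx ξ n ∧
      (ratIdx α n : ℝ) = α * n ∧ (ratIdx ξ n : ℝ) = ξ * n := by
    rintro n hn ⟨hα, hξ⟩
    have el : (ratIdx α n : ℝ) = α * n := by exact_mod_cast congrArg (Rat.cast : ℚ → ℝ) hα
    have em : (ratIdx ξ n : ℝ) = ξ * n := by exact_mod_cast congrArg (Rat.cast : ℚ → ℝ) hξ
    have hn' : (1 : ℝ) ≤ n := by exact_mod_cast hn
    refine ⟨?_, ?_, el, em⟩
    · have : (2 * ratIdx ξ n : ℝ) ≤ n := by rw [em]; nlinarith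
      exact_mod_cast this
    · have : (ratIdx α n : ℝ) < ratIdx ξ n := by rw [el, em]; nlinarith
      exact_mod_cast this
  constructor
  · obtain ⟨K, hK⟩ := exists_swE_standardized_sq_error ha0 hac hc hr0 hr hμ2
    rw [tendsto_iff_dist_tendsto_zero]
    refine squeeze_zero' (g := fun n : ℕ => K / Real.sqrt n)
      (Eventually.of_forall fun _ => dist_nonneg) ?_ ?_
    · rw [eventually_inf_principal]
      filter_upwards [eventually_ge_atTop 1] with n hn hmem
      obtain ⟨hm, hl, el, em⟩ := hreg n hn hmem
      have h := hK n _ _ hm hl el em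
      rwa [hr2, ← hσ2] at h
    · refine Tendsto.mono_left ?_ inf_le_left
      exact tendsto_const_nhds.div_atTop
        (Real.tendsto_sqrt_atTop.comp tendsto_natCast_atTop_atTop)
  · intro j _
    obtain ⟨B, hB⟩ := exists_swE_abs_standardized_le j hr0.le hr hμ2 (by linarith)
    refine ⟨B, ?_⟩
    rw [eventually_inf_principal]
    filter_upwards [eventually_ge_atTop 1] with n hn hmem
    obtain ⟨hm, hl, el, em⟩ := hreg n hn hmem
    exact hB n _ _ hm hl el em
end

section
/- Let α, β > 0 be reals with ξ := α + β ≤ 1/2, and set μ := (1 − √(1 − 4α(1−ξ)))/2. Then h(ξ) + ξ·h(μ/ξ) − α·h(μ/α) − (1−α−μ)·h(β/(1−α−μ)) = h(μ). -/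
/-- The binary entropy `h(t) = −t log t − (1−t) log(1−t)` (natural logarithm,
with the convention `0 · log 0 := 0`, which holds since `Real.log 0 = 0`). -/
noncomputable def binH (t : ℝ) : ℝ := -t * Real.log t - (1 - t) * Real.log (1 - t)

/-- The grouping form of the entropy: `x·h(y/x) = x log x − y log y − (x−y) log (x−y)`. -/
theorem mul_binH_div {x y : ℝ} (hx : 0 < x) (hy : 0 < y) (hyx : y < x) :
    x * binH (y / x) =
      x * Real.log x - y * Real.log y - (x - y) * Real.log (x - y) := by
  have h : 1 - y / x = (x - y) / x := by field_simp
  rw [binH, h, Real.log_div hy.ne' hx.ne', Real.log_div (sub_pos.2 hyx).ne' hx.ne']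
  field_simp
  ring

/-- the leading coefficient identity
`h(ξ) + ξ·h(μ/ξ) − α·h(μ/α) − (1−α−μ)·h(β/(1−α−μ)) = h(μ)`
with `ξ = α + β` and `μ = (1 − √(1 − 4α(1−ξ)))/2`. -/
theorem statement_16 (α β : ℝ) (hα : 0 < α) (hβ : 0 < β)
    (ξ : ℝ) (hξdef : ξ = α + β) (hξ : ξ ≤ 1 / 2)
    (μ : ℝ) (hμ : μ = (1 - Real.sqrt (1 - 4 * α * (1 - ξ))) / 2) :
    binH ξ + ξ * binH (μ / ξ) - α * binH (μ / α)
      - (1 - α - μ) * binH (β / (1 - α - μ)) = binH μ := by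
  have hnn : 0 ≤ 1 - 4 * α * (1 - ξ) := by nlinarith [sq_nonneg (1 - 2 * ξ)]
  have hs := Real.sq_sqrt hnn
  have hs0 := Real.sqrt_nonneg (1 - 4 * α * (1 - ξ))
  have hs1 : Real.sqrt (1 - 4 * α * (1 - ξ)) < 1 := by
    rw [Real.sqrt_lt' one_pos]
    nlinarith
  have hquad : μ * (1 - μ) = α * (1 - ξ) := by
    rw [hμ]
    linear_combination -hs / 4
  have hsq : (1 - 2 * μ) ^ 2 = 1 - 4 * α * (1 - ξ) := by linear_combination -4 * hquad
  have hμ0 : 0 < μ := by linarith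
  have hμ_half : μ ≤ 1 / 2 := by linarith
  have hμ_lt : μ < 1 / 2 := by
    refine lt_of_le_of_ne hμ_half fun h => ?_
    subst h
    nlinarith [sq_nonneg (1 - 2 * ξ)]
  have hγ : 0 < 1 - ξ - μ := by linarith
  have e₁ : (α - μ) * (1 - ξ - μ) = μ * β := by
    linear_combination -hquad + μ * hξdef
  have hαμ : 0 < α - μ := pos_of_mul_pos_left (e₁ ▸ mul_pos hμ0 hβ) hγ.le
  have hδ : 0 < 1 - α - μ := by linarith
  have hξμ : 0 < ξ - μ := by linarith
  have hξ1 : 0 < 1 - ξ := by linarith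
  have hμ1 : 0 < 1 - μ := by linarith
  have e₂ : (ξ - μ) * (1 - α - μ) = β * (1 - μ) := by
    linear_combination -hquad + (1 - μ) * hξdef
  have e₃ : α * (ξ - μ) = (α - μ) * (1 - μ) := by linear_combination hquad
  have l₀ := congrArg Real.log hquad
  have l₁ := congrArg Real.log e₁
  have l₂ := congrArg Real.log e₂
  have l₃ := congrArg Real.log e₃
  rw [Real.log_mul (by positivity) (by positivity),
    Real.log_mul (by positivity) (by positivity)] at l₀ l₁ l₂ l₃
  rw [mul_binH_div (by linarith) hμ0 (by linarith), mul_binH_div hα hμ0 (by linarith),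
    mul_binH_div hδ hβ (by linarith), show 1 - α - μ - β = 1 - ξ - μ by linarith, binH, binH]
  subst hξdef
  linear_combination (1 - (α + β)) * l₀ + (1 - (α + β) - μ) * l₁
    - (1 - α - μ) * l₂ + (1 - α - (α + β)) * l₃
end

section
/- Let β, δ > 0 and ξ ∈ (0,1) be reals with β ≤ ξ and δ ≤ 1 − ξ. Set D := 4βδ + (2ξ−1)² and μ := (1 − √D)/2. Then h(μ) ≥ h(ξ) − (β+δ)·h(β/(β+δ)). -/
open Real in
/-- Jensen's inequality for the logarithm at two points. -/
lemma weighted_log_le_log {p u v : ℝ} (hp0 : 0 ≤ p) (hp1 : p ≤ 1) (hu : 0 < u) (hv : 0 < v) :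
    p * log u + (1 - p) * log v ≤ log (p * u + (1 - p) * v) := by
  have := strictConcaveOn_log_Ioi.concaveOn.2 (Set.mem_Ioi.2 hu) (Set.mem_Ioi.2 hv) hp0
    (sub_nonneg.2 hp1) (by ring)
  simpa [smul_eq_mul] using this

/-- The distance between the eigenvalues of the symmetric matrix with diagonal `x, y` and
squared off-diagonal entry `c`. -/
noncomputable def eigenGap (c x y : ℝ) : ℝ := Real.sqrt ((x - y) ^ 2 + 4 * c)

/-- The unnormalised relative entropy of coherence of the symmetric `2 × 2` matrix with
diagonal `x, y` and squared off-diagonal entry `c`. -/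
noncomputable def coherence (c x y : ℝ) : ℝ :=
  Real.negMulLog x + Real.negMulLog y - Real.negMulLog ((x + y + eigenGap c x y) / 2)
    - Real.negMulLog ((x + y - eigenGap c x y) / 2)

open Real in
/-- Coherence decreases along positive diagonal directions. -/
lemma coherence_deriv_nonpos {x y : ℝ → ℝ} {a d t k : ℝ} (hk : 0 < k)
    (ha : 0 ≤ a) (hd : 0 ≤ d) (hx : HasDerivAt x a t) (hy : HasDerivAt y d t)
    (hx0 : 0 < x t) (hy0 : 0 < y t) (hdet : k < x t * y t) :
    ∃ f', HasDerivAt (fun s => coherence k (x s) (y s)) f' t ∧ f' ≤ 0 := by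
  set R := eigenGap k (x t) (y t) with hR
  have hpos : 0 < (x t - y t) ^ 2 + 4 * k := by positivity
  have hR0 : 0 < R := sqrt_pos.2 hpos
  have hRsq : R ^ 2 = (x t - y t) ^ 2 + 4 * k := sq_sqrt hpos.le
  have hlt : R < x t + y t := by nlinarith
  have habs : |x t - y t| ≤ R := abs_le_of_sq_le_sq (by linarith) hR0.le
  obtain ⟨h1, h2⟩ := abs_le.1 habs
  obtain ⟨p, hp⟩ : ∃ p, p = (1 + (x t - y t) / R) / 2 := ⟨_, rfl⟩
  have hpR : (2 * p - 1) * R = x t - y t := by rw [hp]; field_simp; ring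
  have hp0 : 0 ≤ p := by by_contra! h; nlinarith
  have hp1 : p ≤ 1 := by by_contra! h; nlinarith
  have hgap : HasDerivAt (fun s => eigenGap k (x s) (y s)) ((2 * p - 1) * (a - d)) t := by
    have := (((hx.sub hy).pow 2).add_const (4 * k)).sqrt (by simpa using hpos.ne')
    refine this.congr_deriv ?_
    simp only [Pi.sub_apply, Pi.pow_apply]
    change _ / (2 * R) = _
    rw [hp]; field_simp; push_cast; ring
  have hu : 0 < (x t + y t + R) / 2 := by linarith
  have hv : 0 < (x t + y t - R) / 2 := by linarith
  have hU := (hasDerivAt_negMulLog hu.ne').comp t (((hx.add hy).add hgap).div_const 2)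
  have hV := (hasDerivAt_negMulLog hv.ne').comp t (((hx.add hy).sub hgap).div_const 2)
  have hX := (hasDerivAt_negMulLog hx0.ne').comp t hx
  have hY := (hasDerivAt_negMulLog hy0.ne').comp t hy
  refine ⟨_, ((hX.add hY).sub hU).sub hV, ?_⟩
  have j1 := weighted_log_le_log hp0 hp1 hu hv
  have j2 := weighted_log_le_log hp0 hp1 hv hu
  rw [show p * ((x t + y t + R) / 2) + (1 - p) * ((x t + y t - R) / 2) = x t by
    linear_combination hpR / 2] at j1
  rw [show p * ((x t + y t - R) / 2) + (1 - p) * ((x t + y t + R) / 2) = y t by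
    linear_combination -hpR / 2] at j2
  have m1 := mul_le_mul_of_nonneg_left j1 ha
  have m2 := mul_le_mul_of_nonneg_left j2 hd
  linarith

/-- Adding a nonnegative diagonal matrix to a rank-one matrix does not increase coherence. -/
lemma coherence_add_le {β δ a d : ℝ} (hβ : 0 < β) (hδ : 0 < δ) (ha : 0 ≤ a) (hd : 0 ≤ d) :
    coherence (β * δ) (β + a) (δ + d) ≤ coherence (β * δ) β δ := by
  rcases eq_or_lt_of_le (add_nonneg ha hd) with h | h
  · obtain rfl : a = 0 := by linarith
    obtain rfl : d = 0 := by linarith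
    simp
  have key : ∀ t ∈ interior (Set.Icc (0 : ℝ) 1), ∃ f',
      HasDerivAt (fun s => coherence (β * δ) (β + s * a) (δ + s * d)) f' t ∧ f' ≤ 0 := by
    intro t ht
    rw [interior_Icc] at ht
    have ht0 := ht.1
    refine coherence_deriv_nonpos (mul_pos hβ hδ) ha hd
      (x := fun s => β + s * a) (y := fun s => δ + s * d)
      (by simpa using ((hasDerivAt_id t).mul_const a).const_add β)
      (by simpa using ((hasDerivAt_id t).mul_const d).const_add δ)
      (by positivity) (by positivity) ?_
    have : 0 < a * δ + d * β := by
      rcases ha.eq_or_lt with rfl | ha'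
      · have : 0 < d := by linarith
        positivity
      · positivity
    have h1 := mul_pos ht0 this
    have h2 : 0 ≤ t * a * (t * d) := by positivity
    change _ < (β + t * a) * (δ + t * d)
    linarith
  have hanti : AntitoneOn (fun s => coherence (β * δ) (β + s * a) (δ + s * d))
      (Set.Icc 0 1) := by
    refine antitoneOn_of_deriv_nonpos (convex_Icc 0 1) ?_ ?_ ?_
    · unfold coherence eigenGap
      fun_prop
    · intro t ht
      obtain ⟨_, h, _⟩ := key t ht
      exact h.differentiableAt.differentiableWithinAt
    · intro t ht
      obtain ⟨_, h, h'⟩ := key t ht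
      rwa [h.deriv]
  simpa using hanti (Set.left_mem_Icc.2 zero_le_one) (Set.right_mem_Icc.2 zero_le_one) zero_le_one

/-- The coherence of a rank-one matrix. -/
lemma coherence_rank_one {β δ : ℝ} (hβ : 0 < β) (hδ : 0 < δ) :
    coherence (β * δ) β δ = (β + δ) * binH (β / (β + δ)) := by
  have hs : 0 < β + δ := by positivity
  have hgap : eigenGap (β * δ) β δ = β + δ := by
    rw [eigenGap, show (β - δ) ^ 2 + 4 * (β * δ) = (β + δ) ^ 2 by ring, Real.sqrt_sq hs.le]
  have h1 : 1 - β / (β + δ) = δ / (β + δ) := by field_simp; ring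
  rw [coherence, hgap, binH, h1, Real.log_div hβ.ne' hs.ne', Real.log_div hδ.ne' hs.ne',
    add_self_div_two, sub_self, zero_div]
  simp only [Real.negMulLog]
  field_simp
  ring

/-- the asymmetry of the Dicke state dominates that of the
decohered state: `h(μ) ≥ h(ξ) − (β+δ)·h(β/(β+δ))` where
`D = 4βδ + (2ξ−1)²` and `μ = (1 − √D)/2`. -/
theorem statement_17 (β δ ξ : ℝ) (hβ : 0 < β) (hδ : 0 < δ)
    (hξ0 : 0 < ξ) (hξ1 : ξ < 1) (hβξ : β ≤ ξ) (hδξ : δ ≤ 1 - ξ)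
    (D μ : ℝ) (hD : D = 4 * β * δ + (2 * ξ - 1) ^ 2)
    (hμ : μ = (1 - Real.sqrt D) / 2) :
    binH ξ - (β + δ) * binH (β / (β + δ)) ≤ binH μ := by
  have h := coherence_add_le hβ hδ (sub_nonneg.2 hβξ) (sub_nonneg.2 hδξ)
  rw [coherence_rank_one hβ hδ, add_sub_cancel, add_sub_cancel] at h
  have hgap : eigenGap (β * δ) ξ (1 - ξ) = 1 - 2 * μ := by
    rw [eigenGap, hμ, hD,
      show (ξ - (1 - ξ)) ^ 2 + 4 * (β * δ) = 4 * β * δ + (2 * ξ - 1) ^ 2 by ring]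
    ring
  rw [coherence, hgap, show (ξ + (1 - ξ) + (1 - 2 * μ)) / 2 = 1 - μ by ring,
    show (ξ + (1 - ξ) - (1 - 2 * μ)) / 2 = μ by ring] at h
  simp only [Real.negMulLog] at h
  unfold binH at h ⊢
  linarith
end
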